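/- For every ε with 0 < ε < 1, there exists a natural number n_ε such that for every integer n ≥ n_ε one has n·(1 − 1/log n + (1−ε)·(log log n)/(log² n)) ≤ ϑ(p_n)/log p_{n+1}. -/

import Mathlib

open Real

/-- The Chebyshev theta function: `ϑ(x) = ∑_{p ≤ x} log p`, the sum of the natural
logarithms of the primes not exceeding `x`. -/
noncomputable def chebyshevTheta (x : ℕ) : ℝ :=
  ∑ p ∈ (Finset.range (x + 1)).filter Nat.Prime, Real.log p

/-- `nthPrime n` is the `n`-th prime `p_n` (so `nthPrime 1 = 2`, `nthPrime 2 = 3`, ...). -/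
noncomputable def nthPrime (n : ℕ) : ℕ := Nat.nth Nat.Prime (n - 1)

/-- The Euler–Maclaurin remainder of the zeta series on `[n, n + 1]`. -/
noncomputable def zetaTerm (n : ℕ) (s : ℂ) : ℂ :=
  ((n + 1 : ℕ) : ℂ) ^ (-s) - (((n + 1 : ℕ) : ℂ) ^ (1 - s) - (n : ℂ) ^ (1 - s)) / (1 - s)

lemma norm_cpow_neg_sub_le {a b : ℝ} (ha : 0 < a) (hab : a ≤ b) {s : ℂ} (hs : 0 ≤ s.re) :
    ‖(b : ℂ) ^ (-s) - (a : ℂ) ^ (-s)‖ ≤ ‖s‖ * a ^ (-s.re - 1) * (b - a) := by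
  have hd : ∀ u ∈ Set.Icc a b, HasDerivWithinAt (fun u : ℝ ↦ (u : ℂ) ^ (-s))
      (-s * (u : ℂ) ^ (-s - 1)) (Set.Icc a b) u := by
    intro u hu
    have hu0 : 0 < u := ha.trans_le hu.1
    have h1 := (hasDerivAt_id (u : ℂ)).cpow_const (c := -s) (Or.inl (by simpa using hu0))
    simpa using (h1.comp_ofReal).hasDerivWithinAt
  have hb : ∀ u ∈ Set.Icc a b, ‖-s * (u : ℂ) ^ (-s - 1)‖ ≤ ‖s‖ * a ^ (-s.re - 1) := by
    intro u hu
    have hu0 : 0 < u := ha.trans_le hu.1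
    rw [norm_mul, norm_neg, Complex.norm_cpow_eq_rpow_re_of_pos hu0]
    gcongr
    simp only [Complex.sub_re, Complex.neg_re, Complex.one_re]
    exact Real.rpow_le_rpow_of_nonpos ha hu.1 (by linarith)
  have := (convex_Icc a b).norm_image_sub_le_of_norm_hasDerivWithin_le hd hb
    (Set.left_mem_Icc.2 hab) (Set.right_mem_Icc.2 hab)
  rwa [Real.norm_of_nonneg (by linarith : 0 ≤ b - a)] at this

lemma norm_zetaTerm_le {n : ℕ} (hn : 1 ≤ n) {s : ℂ} (hs : 0 ≤ s.re) (hs1 : s ≠ 1) :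
    ‖zetaTerm n s‖ ≤ ‖s‖ * (n : ℝ) ^ (-s.re - 1) := by
  have hn0 : (0 : ℝ) < n := by exact_mod_cast hn
  have h1s : (1 - s) ≠ 0 := sub_ne_zero.2 hs1.symm
  obtain ⟨a, ha⟩ : ∃ a : ℝ, a = n := ⟨_, rfl⟩
  rw [← ha] at hn0 ⊢
  obtain ⟨b, hb⟩ : ∃ b : ℝ, b = a + 1 := ⟨_, rfl⟩
  have hd : ∀ u ∈ Set.Icc a b,
      HasDerivWithinAt (fun u : ℝ ↦ (u : ℂ) * (b : ℂ) ^ (-s) - (u : ℂ) ^ (1 - s) / (1 - s))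
      ((b : ℂ) ^ (-s) - (u : ℂ) ^ (-s)) (Set.Icc a b) u := by
    intro u hu
    have hu0 : 0 < u := hn0.trans_le hu.1
    have h1 := ((hasDerivAt_id (u : ℂ)).cpow_const (c := 1 - s)
      (Or.inl (by simpa using hu0))).div_const (1 - s)
    have h2 := (hasDerivAt_id (u : ℂ)).mul_const ((b : ℂ) ^ (-s))
    have h3 := ((h2.sub h1).comp_ofReal).hasDerivWithinAt (s := Set.Icc a b)
    convert! h3 using 1
    have : (1 - s - 1) = -s := by ring
    rw [this]
    field_simp
    simp
  have hbd : ∀ u ∈ Set.Icc a b,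
      ‖(b : ℂ) ^ (-s) - (u : ℂ) ^ (-s)‖ ≤ ‖s‖ * a ^ (-s.re - 1) := by
    intro u hu
    have hu0 : 0 < u := hn0.trans_le hu.1
    refine (norm_cpow_neg_sub_le hu0 hu.2 hs).trans ?_
    have h1 : u ^ (-s.re - 1) ≤ a ^ (-s.re - 1) :=
      Real.rpow_le_rpow_of_nonpos hn0 hu.1 (by linarith)
    have h2 : b - u ≤ 1 := by linarith [hu.1]
    have h3 : 0 ≤ ‖s‖ * a ^ (-s.re - 1) := by positivity
    calc ‖s‖ * u ^ (-s.re - 1) * (b - u) ≤ ‖s‖ * a ^ (-s.re - 1) * (b - u) := by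
          gcongr; linarith [hu.2]
      _ ≤ ‖s‖ * a ^ (-s.re - 1) * 1 := by gcongr
      _ = _ := mul_one _
  have := (convex_Icc a b).norm_image_sub_le_of_norm_hasDerivWithin_le hd hbd
    (Set.left_mem_Icc.2 (by linarith)) (Set.right_mem_Icc.2 (by linarith))
  have hba : b - a = 1 := by simp [hb]
  rw [hba, norm_one, mul_one] at this
  convert! this using 2
  simp only [zetaTerm, hb, ha]
  push_cast
  ring

lemma hasSum_zetaTerm {N : ℕ} (hN : 1 ≤ N) {s : ℂ} (hs : 1 < s.re) :
    HasSum (fun k : ℕ ↦ zetaTerm (N + k) s)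
      (riemannZeta s - ∑ n ∈ Finset.range N, ((n + 1 : ℕ) : ℂ) ^ (-s)
        + (N : ℂ) ^ (1 - s) / (1 - s)) := by
  have hs1 : s ≠ 1 := by rintro rfl; simp at hs
  have hsum : Summable (fun k : ℕ ↦ zetaTerm (N + k) s) := by
    refine Summable.of_norm_bounded (g := fun k : ℕ ↦ ‖s‖ * ((N + k : ℕ) : ℝ) ^ (-s.re - 1)) ?_ ?_
    · refine Summable.mul_left _ ?_
      have := Real.summable_nat_rpow.2 (show -s.re - 1 < -1 by linarith)
      exact this.comp_injective (add_right_injective N)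
    · intro k
      exact norm_zetaTerm_le (by omega) (by linarith) hs1
  have hpart : ∀ K : ℕ, ∑ k ∈ Finset.range K, zetaTerm (N + k) s
      = (∑ n ∈ Finset.range (N + K), ((n + 1 : ℕ) : ℂ) ^ (-s))
        - ∑ n ∈ Finset.range N, ((n + 1 : ℕ) : ℂ) ^ (-s)
        + ((N : ℂ) ^ (1 - s) / (1 - s) - ((N + K : ℕ) : ℂ) ^ (1 - s) / (1 - s)) := by
    intro K
    induction K with
    | zero => simp
    | succ K ih =>
      rw [Finset.sum_range_succ, ih, ← add_assoc N K 1, Finset.sum_range_succ, zetaTerm]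
      push_cast
      ring
  have h1 : Filter.Tendsto (fun K : ℕ ↦ ∑ n ∈ Finset.range (N + K), ((n + 1 : ℕ) : ℂ) ^ (-s))
      Filter.atTop (nhds (riemannZeta s)) := by
    have hz : HasSum (fun n : ℕ ↦ ((n + 1 : ℕ) : ℂ) ^ (-s)) (riemannZeta s) := by
      rw [zeta_eq_tsum_one_div_nat_add_one_cpow hs]
      have : Summable (fun n : ℕ ↦ 1 / ((n : ℂ) + 1) ^ s) := by
        have := (Complex.summable_one_div_nat_cpow.2 hs)
        simpa using (summable_nat_add_iff 1).2 this
      convert! this.hasSum using 1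
      ext n
      rw [Complex.cpow_neg]; push_cast; simp
    have := hz.tendsto_sum_nat.comp (Filter.tendsto_add_atTop_nat N)
    refine this.congr fun K ↦ ?_
    simp [add_comm]
  have h2 : Filter.Tendsto (fun K : ℕ ↦ ((N + K : ℕ) : ℂ) ^ (1 - s) / (1 - s))
      Filter.atTop (nhds 0) := by
    rw [tendsto_zero_iff_norm_tendsto_zero]
    have : Filter.Tendsto (fun K : ℕ ↦ ((N + K : ℕ) : ℝ) ^ (-(s.re - 1)) / ‖1 - s‖)
      Filter.atTop (nhds 0) := by
      have h := (tendsto_rpow_neg_atTop (show 0 < s.re - 1 by linarith)).comp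
        (tendsto_natCast_atTop_atTop.comp (Filter.tendsto_add_atTop_nat N))
      have h' := h.div_const ‖1 - s‖
      rw [zero_div] at h'
      refine h'.congr fun K ↦ ?_
      simp [add_comm]
    refine this.congr fun K ↦ ?_
    rw [norm_div, Complex.norm_natCast_cpow_of_pos (by omega)]
    simp
  have h3 := hsum.hasSum.tendsto_sum_nat
  have h4 := (h1.sub_const (∑ n ∈ Finset.range N, ((n + 1 : ℕ) : ℂ) ^ (-s))).add
    (h2.const_sub ((N : ℂ) ^ (1 - s) / (1 - s)))
  rw [sub_zero] at h4
  rw [tendsto_nhds_unique h4 (h3.congr hpart)]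
  exact hsum.hasSum

/-- The truncated Euler–Maclaurin expression for the zeta function. -/
noncomputable def zetaApprox (N : ℕ) (s : ℂ) : ℂ :=
  ∑ n ∈ Finset.range N, ((n + 1 : ℕ) : ℂ) ^ (-s) - (N : ℂ) ^ (1 - s) / (1 - s)
    + ∑' k : ℕ, zetaTerm (N + k) s

lemma riemannZeta_eq_zetaApprox {N : ℕ} (hN : 1 ≤ N) {s : ℂ} (hs : 1 < s.re) :
    riemannZeta s = zetaApprox N s := by
  rw [zetaApprox, (hasSum_zetaTerm hN hs).tsum_eq]
  ring

lemma summable_add_one_rpow : Summable (fun k : ℕ ↦ ((k + 1 : ℕ) : ℝ) ^ (-11 / 8 : ℝ)) :=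
  (summable_nat_add_iff 1).2 (Real.summable_nat_rpow.2 (by norm_num : (-11 / 8 : ℝ) < -1))

lemma norm_zetaTerm_add_le {N : ℕ} {T : ℝ} (hT : 1 ≤ T) (hN : T ^ 2 ≤ N) {w : ℂ}
    (hw : 99 / 100 ≤ w.re) (hw1 : w ≠ 1) (hwn : ‖w‖ ≤ 4 * T) (k : ℕ) :
    ‖zetaTerm (N + k) w‖ ≤ 4 * ((k + 1 : ℕ) : ℝ) ^ (-11 / 8 : ℝ) := by
  have hNpos : (0 : ℝ) < N := by nlinarith
  have hN1 : 1 ≤ N := by exact_mod_cast hNpos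
  have hNk : (1 : ℝ) ≤ ((N + k : ℕ) : ℝ) := by exact_mod_cast (by omega : 1 ≤ N + k)
  have hNN : (N : ℝ) ≤ ((N + k : ℕ) : ℝ) := by exact_mod_cast (by omega : N ≤ N + k)
  have hNk' : ((k + 1 : ℕ) : ℝ) ≤ ((N + k : ℕ) : ℝ) := by exact_mod_cast (by omega : k + 1 ≤ N + k)
  refine (norm_zetaTerm_le (by omega) (by linarith) hw1).trans ?_
  have h1 : ((N + k : ℕ) : ℝ) ^ (-w.re - 1) ≤ ((N + k : ℕ) : ℝ) ^ (-1 / 2 + -11 / 8 : ℝ) :=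
    Real.rpow_le_rpow_of_exponent_le hNk (by linarith)
  rw [Real.rpow_add (by linarith)] at h1
  have h2 : ((N + k : ℕ) : ℝ) ^ (-1 / 2 : ℝ) ≤ T⁻¹ := by
    have h : ((N + k : ℕ) : ℝ) ^ (-1 / 2 : ℝ) ≤ (T ^ 2) ^ (-1 / 2 : ℝ) :=
      Real.rpow_le_rpow_of_nonpos (by positivity) (by linarith) (by norm_num)
    rwa [← Real.rpow_natCast, ← Real.rpow_mul (by linarith), show ((2 : ℕ) : ℝ) * (-1 / 2) = -1 by
      norm_num, Real.rpow_neg_one] at h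
  have h3 : ((N + k : ℕ) : ℝ) ^ (-11 / 8 : ℝ) ≤ ((k + 1 : ℕ) : ℝ) ^ (-11 / 8 : ℝ) :=
    Real.rpow_le_rpow_of_nonpos (by positivity) hNk' (by norm_num)
  calc ‖w‖ * ((N + k : ℕ) : ℝ) ^ (-w.re - 1)
      ≤ (4 * T) * (T⁻¹ * ((k + 1 : ℕ) : ℝ) ^ (-11 / 8 : ℝ)) := by
        gcongr
        exact h1.trans (by gcongr)
    _ = _ := by field_simp

lemma norm_sum_cpow_le {N : ℕ} (hN : 1 ≤ N) {r : ℝ} (hr : 0 < r) {w : ℂ} (hw : 1 - r ≤ w.re) :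
    ‖∑ n ∈ Finset.range N, ((n + 1 : ℕ) : ℂ) ^ (-w)‖ ≤ (1 + 1 / r) * (N : ℝ) ^ (2 * r) := by
  have hN' : (1 : ℝ) ≤ N := by exact_mod_cast hN
  have hNr : 1 ≤ (N : ℝ) ^ r := Real.one_le_rpow hN' hr.le
  have hterm : ∀ n ∈ Finset.range N,
      ‖((n + 1 : ℕ) : ℂ) ^ (-w)‖ ≤ (N : ℝ) ^ r * ((n + 1 : ℕ) : ℝ)⁻¹ := by
    intro n hn
    rw [Finset.mem_range] at hn
    rw [Complex.norm_natCast_cpow_of_pos (by omega), Complex.neg_re]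
    have h1 : (1 : ℝ) ≤ ((n + 1 : ℕ) : ℝ) := by exact_mod_cast (by omega)
    have h2 : ((n + 1 : ℕ) : ℝ) ≤ N := by exact_mod_cast hn
    calc ((n + 1 : ℕ) : ℝ) ^ (-w.re) ≤ ((n + 1 : ℕ) : ℝ) ^ (r + -1) :=
          Real.rpow_le_rpow_of_exponent_le h1 (by linarith)
      _ = ((n + 1 : ℕ) : ℝ) ^ r * ((n + 1 : ℕ) : ℝ)⁻¹ := by
          rw [Real.rpow_add (by linarith), Real.rpow_neg_one]
      _ ≤ _ := by gcongr
  have hh : ∑ n ∈ Finset.range N, ((n + 1 : ℕ) : ℝ)⁻¹ ≤ 1 + Real.log N := by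
    have := harmonic_le_one_add_log N
    simpa [harmonic] using this
  have hl : Real.log N ≤ (N : ℝ) ^ r / r := Real.log_le_rpow_div (by linarith) hr
  calc _ ≤ ∑ n ∈ Finset.range N, (N : ℝ) ^ r * ((n + 1 : ℕ) : ℝ)⁻¹ := norm_sum_le_of_le _ hterm
    _ = (N : ℝ) ^ r * ∑ n ∈ Finset.range N, ((n + 1 : ℕ) : ℝ)⁻¹ := by rw [Finset.mul_sum]
    _ ≤ (N : ℝ) ^ r * ((N : ℝ) ^ r + (N : ℝ) ^ r / r) := by
        gcongr
        linarith
    _ = _ := by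
        rw [show 2 * r = r + r by ring, Real.rpow_add (by linarith)]
        ring

lemma norm_zetaApprox_le {N : ℕ} {T : ℝ} (hT : 1 ≤ T) (hN : T ^ 2 ≤ N) (hN2 : N ≤ 2 * T ^ 2)
    {w : ℂ} (hw : 1 - 1 / 192 ≤ w.re) (hw1 : 1 / 2 ≤ ‖1 - w‖) (hwn : ‖w‖ ≤ 4 * T) :
    ‖zetaApprox N w‖ ≤ (390 + 4 * ∑' k : ℕ, ((k + 1 : ℕ) : ℝ) ^ (-11 / 8 : ℝ))
      * T ^ (1 / 48 : ℝ) := by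
  have hNpos : (0 : ℝ) < N := by nlinarith
  have hN1 : 1 ≤ N := by exact_mod_cast hNpos
  have hN1' : (1 : ℝ) ≤ N := by exact_mod_cast hN1
  have hw1' : w ≠ 1 := by rintro rfl; norm_num at hw1
  set S := ∑' k : ℕ, ((k + 1 : ℕ) : ℝ) ^ (-11 / 8 : ℝ) with hS
  have hTp : 1 ≤ T ^ (1 / 48 : ℝ) := Real.one_le_rpow hT (by norm_num)
  have hNT : (N : ℝ) ^ (2 * (1 / 192) : ℝ) ≤ 2 * T ^ (1 / 48 : ℝ) := by
    calc (N : ℝ) ^ (2 * (1 / 192) : ℝ) ≤ (2 * T ^ 2) ^ (2 * (1 / 192) : ℝ) := by gcongr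
      _ = 2 ^ (2 * (1 / 192) : ℝ) * T ^ (1 / 48 : ℝ) := by
        rw [Real.mul_rpow (by norm_num) (by positivity), ← Real.rpow_natCast T,
          ← Real.rpow_mul (by linarith)]
        norm_num
      _ ≤ 2 ^ (1 : ℝ) * T ^ (1 / 48 : ℝ) := by
        gcongr
        · norm_num
        · norm_num
      _ = _ := by rw [Real.rpow_one]
  have h1 := norm_sum_cpow_le hN1 (by norm_num : (0 : ℝ) < 1 / 192) hw
  have h2 : ‖(N : ℂ) ^ (1 - w) / (1 - w)‖ ≤ 2 * (N : ℝ) ^ (2 * (1 / 192) : ℝ) := by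
    rw [norm_div, Complex.norm_natCast_cpow_of_pos (by omega), div_le_iff₀ (by linarith)]
    have : (N : ℝ) ^ (1 - w).re ≤ (N : ℝ) ^ (2 * (1 / 192) : ℝ) := by
      apply Real.rpow_le_rpow_of_exponent_le hN1'
      simp only [Complex.sub_re, Complex.one_re]
      linarith
    have h0 : 0 ≤ (N : ℝ) ^ (2 * (1 / 192) : ℝ) := by positivity
    nlinarith
  have h3 : ‖∑' k : ℕ, zetaTerm (N + k) w‖ ≤ 4 * S := by
    refine tsum_of_norm_bounded (summable_add_one_rpow.hasSum.mul_left 4) fun k ↦ ?_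
    exact norm_zetaTerm_add_le hT hN (by linarith) hw1' hwn k
  have hS0 : 0 ≤ S := tsum_nonneg fun k ↦ by positivity
  rw [zetaApprox]
  refine (norm_add_le _ _).trans ?_
  have := norm_sub_le (∑ n ∈ Finset.range N, ((n + 1 : ℕ) : ℂ) ^ (-w)) ((N : ℂ) ^ (1 - w) / (1 - w))
  nlinarith

lemma differentiableOn_zetaApprox {N : ℕ} {T : ℝ} (hT : 1 ≤ T) (hN : T ^ 2 ≤ N) {U : Set ℂ}
    (hU : IsOpen U) (hre : ∀ w ∈ U, 99 / 100 ≤ w.re) (h1 : ∀ w ∈ U, w ≠ 1)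
    (hn : ∀ w ∈ U, ‖w‖ ≤ 4 * T) : DifferentiableOn ℂ (zetaApprox N) U := by
  have hNpos : (0 : ℝ) < N := by nlinarith
  have hN1 : 1 ≤ N := by exact_mod_cast hNpos
  have hN0 : (N : ℂ) ≠ 0 := by exact_mod_cast (by omega : N ≠ 0)
  have hpow : ∀ n : ℕ, 1 ≤ n → Differentiable ℂ (fun s : ℂ ↦ (n : ℂ) ^ (1 - s)) := by
    intro n hn s
    exact (differentiableAt_id.const_sub 1).const_cpow
      (Or.inl (by exact_mod_cast (by omega : n ≠ 0)))
  have hpow' : ∀ n : ℕ, 1 ≤ n → Differentiable ℂ (fun s : ℂ ↦ (n : ℂ) ^ (-s)) := by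
    intro n hn s
    exact (differentiableAt_id.neg).const_cpow (Or.inl (by exact_mod_cast (by omega : n ≠ 0)))
  have hsub : ∀ w ∈ U, (1 - w) ≠ 0 := fun w hw ↦ sub_ne_zero.2 (h1 w hw).symm
  have hd : DifferentiableOn ℂ (fun s : ℂ ↦ 1 - s) U := by fun_prop
  unfold zetaApprox
  refine DifferentiableOn.add (DifferentiableOn.sub ?_ ?_) ?_
  · exact DifferentiableOn.fun_sum fun n _ ↦ (hpow' (n + 1) (by omega)).differentiableOn
  · exact ((hpow N hN1).differentiableOn).div hd hsub
  · refine Complex.differentiableOn_tsum_of_summable_norm (summable_add_one_rpow.mul_left 4) ?_ hU ?_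
    · intro k
      unfold zetaTerm
      refine DifferentiableOn.sub (hpow' _ (by omega)).differentiableOn ?_
      exact ((hpow _ (by omega)).differentiableOn.sub (hpow _ (by omega)).differentiableOn).div hd hsub
    · intro k w hw
      exact norm_zetaTerm_add_le hT hN (hre w hw) (h1 w hw) (hn w hw) k

/-- A subpolynomial vertical growth bound for the zeta function and its first derivatives to the
right of the line `re s = 1`. -/
lemma exists_norm_iteratedDeriv_riemannZeta_le :
    ∃ C : ℝ, 1 ≤ C ∧ ∀ s : ℂ, 1 < s.re → s.re ≤ 2 → 1 ≤ |s.im| → ∀ j ≤ 3,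
      ‖iteratedDeriv j riemannZeta s‖ ≤ C * |s.im| ^ (1 / 48 : ℝ) := by
  set S := ∑' k : ℕ, ((k + 1 : ℕ) : ℝ) ^ (-11 / 8 : ℝ) with hS
  have hS0 : 0 ≤ S := tsum_nonneg fun k ↦ by positivity
  refine ⟨6 * (390 + 4 * S) * 192 ^ 3, by linarith, fun s hs1 hs2 hT j hj ↦ ?_⟩
  set T := |s.im| with hTdef
  set N := ⌈T ^ 2⌉₊ with hNdef
  have hN : T ^ 2 ≤ N := Nat.le_ceil _
  have hN2 : (N : ℝ) ≤ 2 * T ^ 2 := by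
    have := (Nat.ceil_lt_add_one (by positivity : 0 ≤ T ^ 2)).le
    nlinarith
  have hN1 : 1 ≤ N := by
    have : (0 : ℝ) < N := by nlinarith
    exact_mod_cast this
  have hsn : ‖s‖ ≤ 2 + T := by
    refine (Complex.norm_le_abs_re_add_abs_im s).trans ?_
    rw [abs_of_pos (by linarith)]
    linarith
  have key : ∀ w : ℂ, ‖w - s‖ < 1 / 100 → 99 / 100 ≤ w.re ∧ 1 / 2 ≤ ‖1 - w‖ ∧ ‖w‖ ≤ 4 * T := by
    intro w hw
    have a1 := (Complex.abs_re_le_norm (w - s)).trans hw.le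
    have a2 := (Complex.abs_im_le_norm (w - s)).trans hw.le
    have a3 := Complex.abs_im_le_norm (1 - w)
    rw [Complex.sub_re, abs_le] at a1
    rw [Complex.sub_im] at a2
    rw [Complex.sub_im, Complex.one_im, zero_sub, abs_neg] at a3
    have a4 := abs_sub_abs_le_abs_sub s.im w.im
    rw [abs_sub_comm] at a4
    have a5 := norm_sub_norm_le w s
    exact ⟨by linarith, by linarith, by linarith⟩
  have hd : DifferentiableOn ℂ (zetaApprox N) (Metric.ball s (1 / 100)) := by
    refine differentiableOn_zetaApprox hT hN Metric.isOpen_ball ?_ ?_ ?_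
    · intro w hw; exact (key w (by simpa [dist_eq_norm] using hw)).1
    · rintro w hw rfl
      have := (key 1 (by simpa [dist_eq_norm] using hw)).2.1
      norm_num at this
    · intro w hw; exact (key w (by simpa [dist_eq_norm] using hw)).2.2
  have heq : riemannZeta =ᶠ[nhds s] zetaApprox N := by
    filter_upwards [(isOpen_lt continuous_const Complex.continuous_re).mem_nhds hs1] with w hw
    exact riemannZeta_eq_zetaApprox hN1 hw
  rw [heq.iteratedDeriv_eq]
  have hb := Complex.norm_iteratedDeriv_le_of_forall_mem_sphere_norm_le j
    (by norm_num : (0 : ℝ) < 1 / 192)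
    (hd.diffContOnCl_ball (Metric.closedBall_subset_ball (by norm_num : (1 / 192 : ℝ) < 1 / 100)))
    (C := (390 + 4 * S) * T ^ (1 / 48 : ℝ)) (by
      intro z hz
      rw [mem_sphere_iff_norm] at hz
      obtain ⟨k1, k2, k3⟩ := key z (by rw [hz]; norm_num)
      refine norm_zetaApprox_le hT hN hN2 ?_ k2 k3
      have a1 := (Complex.abs_re_le_norm (z - s)).trans hz.le
      rw [Complex.sub_re, abs_le] at a1
      linarith)
  refine hb.trans ?_
  have hTp : 0 ≤ T ^ (1 / 48 : ℝ) := by positivity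
  have hfac : (j.factorial : ℝ) ≤ 6 := by
    exact_mod_cast (Nat.factorial_le hj).trans (by decide)
  have hpow : ((192 : ℝ)) ^ j ≤ 192 ^ 3 := pow_le_pow_right₀ (by norm_num) hj
  rw [one_div_pow, div_div_eq_mul_div, div_one]
  calc (j.factorial : ℝ) * ((390 + 4 * S) * T ^ (1 / 48 : ℝ)) * 192 ^ j
      ≤ 6 * ((390 + 4 * S) * T ^ (1 / 48 : ℝ)) * 192 ^ 3 := by gcongr
    _ = _ := by ring

lemma exists_norm_riemannZeta_one_add_le :
    ∃ D : ℝ, 1 ≤ D ∧ ∀ x : ℝ, 0 < x → x ≤ 1 → ‖riemannZeta (1 + x)‖ ≤ D / x := by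
  have hc : ContinuousOn (fun x : ℝ ↦ riemannZeta₀ (1 + x)) (Set.Icc 0 1) := by
    have := differentiable_riemannZeta₀.continuous
    fun_prop
  obtain ⟨K, hK⟩ := isCompact_Icc.exists_bound_of_continuousOn hc
  have hK0 : 0 ≤ K := (norm_nonneg _).trans (hK 0 (by simp))
  refine ⟨1 + K, by linarith, fun x hx hx1 ↦ ?_⟩
  have hne : (1 + x : ℂ) ≠ 1 := by simpa using hx.ne'
  rw [riemannZeta_eq_inv_sub_add hne, le_div_iff₀ hx]
  have h1 : ‖((1 + x : ℂ) - 1)⁻¹‖ = x⁻¹ := by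
    simp [abs_of_pos hx]
  have h2 := norm_add_le ((1 + x : ℂ) - 1)⁻¹ (riemannZeta₀ (1 + x))
  have h3 := hK x ⟨hx.le, hx1⟩
  rw [h1] at h2
  calc _ ≤ (x⁻¹ + K) * x := by gcongr; linarith
    _ = 1 + K * x := by field_simp
    _ ≤ _ := by nlinarith

lemma one_le_norm_riemannZeta_product {x : ℝ} (hx : 0 < x) (y : ℝ) :
    1 ≤ ‖riemannZeta (1 + x)‖ ^ 3 * ‖riemannZeta (1 + x + Complex.I * y)‖ ^ 4 *
      ‖riemannZeta (1 + x + 2 * Complex.I * y)‖ := by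
  have := DirichletCharacter.norm_LFunction_product_ge_one (1 : DirichletCharacter ℂ 1) hx y
  simpa [DirichletCharacter.LFunctionTrivChar, norm_mul, norm_pow] using this

lemma pow_four_le_norm_riemannZeta {D B t x : ℝ} (hD : 1 ≤ D) (hB : 1 ≤ B) (hx : 0 < x)
    (h1 : ‖riemannZeta (1 + x)‖ ≤ D / x)
    (h2 : ‖riemannZeta (1 + x + 2 * Complex.I * t)‖ ≤ B) {y : ℝ} (hy : 0 < y) (hyx : y ^ 4 ≤ x) :
    y ^ 3 / (D * B) ≤ ‖riemannZeta (1 + x + Complex.I * t)‖ := by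
  have h := one_le_norm_riemannZeta_product hx t
  set z := ‖riemannZeta (1 + x + Complex.I * t)‖
  have hz : 0 ≤ z := norm_nonneg _
  have h3 : 1 ≤ (D / x) ^ 3 * z ^ 4 * B := h.trans (by gcongr)
  have h4 : x ^ 3 ≤ D ^ 3 * z ^ 4 * B := by
    have hx3 : 0 < x ^ 3 := by positivity
    calc x ^ 3 = x ^ 3 * 1 := by ring
      _ ≤ x ^ 3 * ((D / x) ^ 3 * z ^ 4 * B) := by gcongr
      _ = _ := by field_simp
  rw [div_le_iff₀ (by positivity)]
  refine le_of_pow_le_pow_left₀ (n := 4) (by norm_num) (by positivity) ?_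
  calc (y ^ 3) ^ 4 = (y ^ 4) ^ 3 := by ring
    _ ≤ x ^ 3 := by gcongr
    _ ≤ D ^ 3 * z ^ 4 * B := h4
    _ ≤ D ^ 4 * z ^ 4 * B ^ 4 := by
      gcongr
      · norm_num
      · exact le_self_pow₀ hB (by norm_num)
    _ = _ := by ring

lemma inv_norm_riemannZeta_le {D B t : ℝ} (hD : 1 ≤ D) (hB : 1 ≤ B) (ht : t ≠ 0)
    (h1 : ∀ x : ℝ, 0 < x → x ≤ 1 → ‖riemannZeta (1 + x)‖ ≤ D / x)
    (h2 : ∀ x : ℝ, 0 < x → x ≤ 1 → ‖riemannZeta (1 + x + 2 * Complex.I * t)‖ ≤ B)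
    (h3 : ∀ x : ℝ, 0 < x → x ≤ 1 → ‖deriv riemannZeta (1 + x + Complex.I * t)‖ ≤ B)
    {x : ℝ} (hx : 0 < x) (hx1 : x ≤ 1) :
    ‖riemannZeta (1 + x + Complex.I * t)‖⁻¹ ≤ 16 * D ^ 4 * B ^ 7 := by
  set y : ℝ := 1 / (2 * D * B ^ 2) with hy
  have hy0 : 0 < y := by positivity
  have hB2 : 1 ≤ B ^ 2 := one_le_pow₀ hB
  have hDB : 1 ≤ 2 * D * B ^ 2 := by nlinarith
  have hy1 : y ≤ 1 := by
    rw [hy, div_le_one (by positivity)]; exact hDB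
  have hy4 : y ^ 4 ≤ 1 := pow_le_one₀ hy0.le hy1
  have hyp : y ^ 3 / (D * B) - y ^ 4 * B = (16 * D ^ 4 * B ^ 7)⁻¹ := by
    rw [hy]; field_simp; norm_num
  suffices hmain : (16 * D ^ 4 * B ^ 7)⁻¹ ≤ ‖riemannZeta (1 + x + Complex.I * t)‖ from
    inv_le_of_inv_le₀ (by positivity) hmain
  have hyB : 0 ≤ y ^ 4 * B := by positivity
  rcases le_total (y ^ 4) x with hyx | hyx
  · have := pow_four_le_norm_riemannZeta (t := t) hD hB hx (h1 x hx hx1) (h2 x hx hx1) hy0 hyx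
    linarith
  · have h5 := pow_four_le_norm_riemannZeta (t := t) hD hB (pow_pos hy0 4)
      (h1 _ (pow_pos hy0 4) hy4) (h2 _ (pow_pos hy0 4) hy4) hy0 le_rfl
    have hd : ∀ u ∈ Set.Icc x (y ^ 4), HasDerivWithinAt
        (fun u : ℝ ↦ riemannZeta (1 + u + Complex.I * t))
        (deriv riemannZeta (1 + u + Complex.I * t)) (Set.Icc x (y ^ 4)) u := by
      intro u hu
      have hne : (1 + u + Complex.I * t : ℂ) ≠ 1 := by
        intro h
        have := congrArg Complex.im h
        simp [ht] at this
      have hz := (differentiableAt_riemannZeta hne).hasDerivAt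
      have hl : HasDerivAt (fun u : ℂ ↦ 1 + u + Complex.I * t) 1 (u : ℂ) :=
        ((hasDerivAt_id (u : ℂ)).const_add 1).add_const _
      have := (HasDerivAt.comp (u : ℂ) hz hl).comp_ofReal
      simpa using this.hasDerivWithinAt
    have h6 := (convex_Icc x (y ^ 4)).norm_image_sub_le_of_norm_hasDerivWithin_le hd
      (fun u hu ↦ h3 u (hx.trans_le hu.1) (hu.2.trans hy4))
      (Set.left_mem_Icc.2 hyx) (Set.right_mem_Icc.2 hyx)
    rw [Real.norm_of_nonneg (by linarith)] at h6
    have h7 := norm_sub_norm_le (riemannZeta (1 + (y ^ 4 : ℝ) + Complex.I * t))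
      (riemannZeta (1 + x + Complex.I * t))
    have h8 : B * (y ^ 4 - x) ≤ y ^ 4 * B := by nlinarith
    linarith

/-- The Dirichlet series of `Λ - 1`, expressed through the zeta function. -/
noncomputable def zetaDiff (s : ℂ) : ℂ := -deriv riemannZeta s / riemannZeta s - riemannZeta s

lemma analyticAt_riemannZeta {s : ℂ} (hs : s ≠ 1) : AnalyticAt ℂ riemannZeta s :=
  (differentiableOn_riemannZeta.analyticOnNhd isOpen_compl_singleton) s hs

lemma iteratedDeriv_two_zetaDiff {s : ℂ} (hs : 1 < s.re) :
    iteratedDeriv 2 zetaDiff s = -(iteratedDeriv 3 riemannZeta s / riemannZeta s)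
      + 3 * (iteratedDeriv 1 riemannZeta s * iteratedDeriv 2 riemannZeta s / riemannZeta s ^ 2)
      - 2 * (iteratedDeriv 1 riemannZeta s ^ 3 / riemannZeta s ^ 3)
      - iteratedDeriv 2 riemannZeta s := by
  have hd : ∀ j : ℕ, ∀ w : ℂ, 1 < w.re →
      HasDerivAt (iteratedDeriv j riemannZeta) (iteratedDeriv (j + 1) riemannZeta w) w := by
    intro j w hw
    have hw1 : w ≠ 1 := by rintro rfl; simp at hw
    rw [iteratedDeriv_succ]
    have ha : AnalyticAt ℂ (iteratedDeriv j riemannZeta) w := by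
      rw [iteratedDeriv_eq_iterate]
      exact (analyticAt_riemannZeta hw1).iterated_deriv j
    exact ha.differentiableAt.hasDerivAt
  have h0 : iteratedDeriv 0 riemannZeta = riemannZeta := iteratedDeriv_zero
  have h1 : deriv riemannZeta = iteratedDeriv 1 riemannZeta := iteratedDeriv_one.symm
  have hne : ∀ w : ℂ, 1 < w.re → riemannZeta w ≠ 0 := fun w hw ↦
    riemannZeta_ne_zero_of_one_lt_re hw
  have hd0 : ∀ w : ℂ, 1 < w.re → HasDerivAt riemannZeta (iteratedDeriv 1 riemannZeta w) w := by
    intro w hw; simpa [h0] using hd 0 w hw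
  have hF1 : ∀ w : ℂ, 1 < w.re → deriv zetaDiff w =
      (-iteratedDeriv 2 riemannZeta w * riemannZeta w
        - -iteratedDeriv 1 riemannZeta w * iteratedDeriv 1 riemannZeta w) / riemannZeta w ^ 2
      - iteratedDeriv 1 riemannZeta w := by
    intro w hw
    have := (((hd 1 w hw).neg).div (hd0 w hw) (hne w hw)).sub (hd0 w hw)
    refine Eq.trans (congrArg (fun f ↦ deriv f w) ?_) this.deriv
    ext z
    simp only [zetaDiff, h1, Pi.sub_apply, Pi.div_apply, Pi.neg_apply]
  have heq : deriv zetaDiff =ᶠ[nhds s] fun w ↦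
      (-iteratedDeriv 2 riemannZeta w * riemannZeta w
        - -iteratedDeriv 1 riemannZeta w * iteratedDeriv 1 riemannZeta w) / riemannZeta w ^ 2
      - iteratedDeriv 1 riemannZeta w := by
    filter_upwards [(isOpen_lt continuous_const Complex.continuous_re).mem_nhds hs] with w hw
    exact hF1 w hw
  rw [iteratedDeriv_succ, iteratedDeriv_one, heq.deriv_eq]
  have hz := hne s hs
  have := (((((hd 2 s hs).neg.mul (hd0 s hs)).sub ((hd 1 s hs).neg.mul (hd 1 s hs))).div
    ((hd0 s hs).pow 2) (pow_ne_zero 2 hz)).sub (hd 1 s hs)).deriv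
  refine Eq.trans ?_ (this.trans ?_)
  · rfl
  · simp only [Pi.mul_apply, Pi.neg_apply, Pi.sub_apply, Pi.pow_apply]
    field_simp
    push_cast
    ring

lemma zetaDiff_eq {s : ℂ} (hs : 1 < s.re) :
    zetaDiff s = -deriv riemannZeta₁ s / riemannZeta₁ s - riemannZeta₀ s := by
  have hs1 : s ≠ 1 := by rintro rfl; simp at hs
  have hs' : s - 1 ≠ 0 := sub_ne_zero.2 hs1
  have hz := riemannZeta_ne_zero_of_one_lt_re hs
  have h1 : riemannZeta₁ s ≠ 0 := by
    intro h; rw [riemannZeta_eq_inv_sub_mul hs1, h] at hz; simp at hz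
  rw [zetaDiff, deriv_riemannZeta_eq_neg_inv_sub_sq_mul_add hs1]
  rw [show ∀ a b : ℂ, a / riemannZeta s - b = a / ((s - 1)⁻¹ * riemannZeta₁ s) - b by
    intro a b; rw [riemannZeta_eq_inv_sub_mul hs1]]
  rw [riemannZeta_eq_inv_sub_add hs1]
  field_simp
  ring

lemma riemannZeta₁_ne_zero {s : ℂ} (hs : 1 ≤ s.re) : riemannZeta₁ s ≠ 0 := by
  by_cases hs1 : s = 1
  · simp [hs1]
  · intro h
    have := riemannZeta_ne_zero_of_one_le_re hs
    rw [riemannZeta_eq_inv_sub_mul hs1, h] at this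
    simp at this

lemma exists_norm_iteratedDeriv_zetaDiff_le_of_abs_im_le_one :
    ∃ K : ℝ, ∀ s : ℂ, 1 < s.re → s.re ≤ 2 → |s.im| ≤ 1 → ‖iteratedDeriv 2 zetaDiff s‖ ≤ K := by
  set g : ℂ → ℂ := fun s ↦ -deriv riemannZeta₁ s / riemannZeta₁ s - riemannZeta₀ s with hg
  have hana : ∀ s : ℂ, 1 ≤ s.re → AnalyticAt ℂ g s := by
    intro s hs
    have h1 := differentiable_riemannZeta₁.analyticAt s
    exact ((h1.deriv.neg).div h1 (riemannZeta₁_ne_zero hs)).sub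
      (differentiable_riemannZeta₀.analyticAt s)
  have hcont : ContinuousOn (iteratedDeriv 2 g) (Set.Icc 1 2 ×ℂ Set.Icc (-1) 1) := by
    intro s hs
    rw [iteratedDeriv_eq_iterate]
    exact ((hana s hs.1.1).iterated_deriv 2).continuousAt.continuousWithinAt
  obtain ⟨K, hK⟩ := (isCompact_Icc.reProdIm isCompact_Icc).exists_bound_of_continuousOn hcont
  refine ⟨K, fun s h1 h2 h3 ↦ ?_⟩
  have heq : zetaDiff =ᶠ[nhds s] g := by
    filter_upwards [(isOpen_lt continuous_const Complex.continuous_re).mem_nhds h1] with w hw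
    exact zetaDiff_eq hw
  rw [heq.iteratedDeriv_eq]
  exact hK s ⟨⟨h1.le, h2⟩, abs_le.1 h3⟩

lemma exists_norm_iteratedDeriv_zetaDiff_le :
    ∃ K : ℝ, ∀ s : ℂ, 1 < s.re → s.re ≤ 2 →
      ‖iteratedDeriv 2 zetaDiff s‖ ≤ K * (1 + |s.im|) ^ (1 / 2 : ℝ) := by
  obtain ⟨K, hK⟩ := exists_norm_iteratedDeriv_zetaDiff_le_of_abs_im_le_one
  obtain ⟨C, hC, hCb⟩ := exists_norm_iteratedDeriv_riemannZeta_le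
  obtain ⟨D, hD, hDb⟩ := exists_norm_riemannZeta_one_add_le
  refine ⟨max K (7 * (16 * D ^ 4) ^ 3 * C ^ 24 * 2), fun s hs1 hs2 ↦ ?_⟩
  rcases le_total |s.im| 1 with ht | ht
  · refine (hK s hs1 hs2 ht).trans ?_
    have : 1 ≤ (1 + |s.im|) ^ (1 / 2 : ℝ) :=
      Real.one_le_rpow (by linarith [abs_nonneg s.im]) (by norm_num)
    have hK0 : 0 ≤ max K (7 * (16 * D ^ 4) ^ 3 * C ^ 24 * 2) := le_max_of_le_right (by positivity)
    nlinarith [le_max_left K (7 * (16 * D ^ 4) ^ 3 * C ^ 24 * 2)]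
  · set t := s.im with htdef
    set B : ℝ := C * (2 * |t|) ^ (1 / 48 : ℝ) with hBdef
    have hB1 : 1 ≤ B := by
      have : 1 ≤ (2 * |t|) ^ (1 / 48 : ℝ) := Real.one_le_rpow (by linarith) (by norm_num)
      nlinarith
    have hBt : C * |t| ^ (1 / 48 : ℝ) ≤ B := by
      rw [hBdef]
      gcongr
      linarith
    have hs : s = 1 + ((s.re - 1 : ℝ) : ℂ) + Complex.I * t := by
      apply Complex.ext <;> simp [htdef]
    have hA := inv_norm_riemannZeta_le (D := D) (B := B) (t := t) hD hB1
      (by rintro h; rw [h] at ht; norm_num at ht) hDb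
      (by
        intro x hx hx1
        have := hCb (1 + x + 2 * Complex.I * t) (by simp [hx]) (by simp; linarith)
          (by simp [abs_mul]; linarith) 0 (by norm_num)
        simpa [abs_mul, hBdef] using this)
      (by
        intro x hx hx1
        have := hCb (1 + x + Complex.I * t) (by simp [hx]) (by simp; linarith)
          (by simpa using ht) 1 (by norm_num)
        rw [iteratedDeriv_one] at this
        refine this.trans ?_
        simpa using hBt)
      (x := s.re - 1) (by linarith) (by linarith)
    rw [← hs] at hA
    set A := 16 * D ^ 4 * B ^ 7 with hAdef
    have hA1 : 1 ≤ A := by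
      have h1 : 1 ≤ D ^ 4 := one_le_pow₀ hD
      have h2 : 1 ≤ B ^ 7 := one_le_pow₀ hB1
      rw [hAdef]; nlinarith
    have hb : ∀ j ≤ 3, ‖iteratedDeriv j riemannZeta s‖ ≤ B := fun j hj ↦
      (hCb s hs1 hs2 ht j hj).trans hBt
    have e1 : ‖iteratedDeriv 3 riemannZeta s / riemannZeta s‖ ≤ B ^ 3 * A ^ 3 := by
      rw [div_eq_mul_inv, norm_mul, norm_inv]
      calc _ ≤ B * A := by gcongr; exact hb 3 le_rfl
        _ ≤ B ^ 3 * A ^ 3 := by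
          gcongr
          · exact le_self_pow₀ hB1 (by norm_num)
          · exact le_self_pow₀ hA1 (by norm_num)
    have e2 : ‖iteratedDeriv 1 riemannZeta s * iteratedDeriv 2 riemannZeta s / riemannZeta s ^ 2‖
        ≤ B ^ 3 * A ^ 3 := by
      rw [div_eq_mul_inv, norm_mul, norm_inv, norm_mul, norm_pow, ← inv_pow]
      calc _ ≤ B * B * A ^ 2 := by
            gcongr
            · exact hb 1 (by norm_num)
            · exact hb 2 (by norm_num)
        _ = B ^ 2 * A ^ 2 := by ring
        _ ≤ B ^ 3 * A ^ 3 := by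
          gcongr
          · norm_num
          · norm_num
    have e3 : ‖iteratedDeriv 1 riemannZeta s ^ 3 / riemannZeta s ^ 3‖ ≤ B ^ 3 * A ^ 3 := by
      rw [div_eq_mul_inv, norm_mul, norm_inv, norm_pow, norm_pow, ← inv_pow]
      gcongr
      exact hb 1 (by norm_num)
    have e4 : ‖iteratedDeriv 2 riemannZeta s‖ ≤ B ^ 3 * A ^ 3 := by
      refine (hb 2 (by norm_num)).trans ?_
      calc B = B ^ 1 * 1 := by ring
        _ ≤ B ^ 3 * A ^ 3 := by
          gcongr
          · norm_num
          · exact one_le_pow₀ hA1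
    have hBA : B ^ 3 * A ^ 3 = (16 * D ^ 4) ^ 3 * C ^ 24 * (2 * |t|) ^ (1 / 2 : ℝ) := by
      have hp : ((2 * |t|) ^ (1 / 48 : ℝ)) ^ 24 = (2 * |t|) ^ (1 / 2 : ℝ) := by
        rw [← Real.rpow_natCast, ← Real.rpow_mul (by positivity)]
        norm_num
      rw [← hp, hAdef, hBdef]
      ring
    have hsq : (2 * |t|) ^ (1 / 2 : ℝ) ≤ 2 * (1 + |t|) ^ (1 / 2 : ℝ) := by
      rw [Real.mul_rpow (by norm_num) (by positivity)]
      gcongr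
      · calc (2 : ℝ) ^ (1 / 2 : ℝ) ≤ 2 ^ (1 : ℝ) :=
            Real.rpow_le_rpow_of_exponent_le (by norm_num) (by norm_num)
          _ = 2 := Real.rpow_one 2
      · linarith
    rw [iteratedDeriv_two_zetaDiff hs1]
    calc _ ≤ 7 * (B ^ 3 * A ^ 3) := by
          refine (norm_sub_le _ _).trans ?_
          refine (add_le_add_left (norm_sub_le _ _) _).trans ?_
          refine (add_le_add_left (add_le_add_left (norm_add_le _ _) _) _).trans ?_
          rw [norm_neg, norm_mul, norm_mul]
          norm_num only [RCLike.norm_ofNat]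
          linarith
      _ ≤ 7 * ((16 * D ^ 4) ^ 3 * C ^ 24 * (2 * (1 + |t|) ^ (1 / 2 : ℝ))) := by
          rw [hBA]; gcongr
      _ = (7 * (16 * D ^ 4) ^ 3 * C ^ 24 * 2) * (1 + |t|) ^ (1 / 2 : ℝ) := by ring
      _ ≤ _ := by gcongr; exact le_max_right _ _

/-- The Cesàro kernel `u ↦ max (1 - u) 0` on `(0, ∞)`. -/
noncomputable def cesaroKernel (u : ℝ) : ℂ :=
  Set.indicator (Set.Ioc 0 1) (fun _ ↦ (1 : ℂ)) u
    - Set.indicator (Set.Ioc 0 1) (fun t : ℝ ↦ (t : ℂ) ^ (1 : ℂ)) u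

lemma cesaroKernel_of_pos {u : ℝ} (hu : 0 < u) :
    cesaroKernel u = ((max (1 - u) 0 : ℝ) : ℂ) := by
  by_cases h : u ≤ 1
  · have : u ∈ Set.Ioc (0 : ℝ) 1 := ⟨hu, h⟩
    rw [max_eq_left (by linarith)]
    simp [cesaroKernel, this]
  · have : u ∉ Set.Ioc (0 : ℝ) 1 := fun h' ↦ h h'.2
    rw [max_eq_right (by linarith)]
    simp [cesaroKernel, this]

lemma hasMellin_cesaroKernel {s : ℂ} (hs : 0 < s.re) :
    HasMellin cesaroKernel s (1 / (s * (s + 1))) := by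
  have h1 := hasMellin_one_Ioc hs
  have h2 := hasMellin_cpow_Ioc 1 (s := s) (by simp; linarith)
  have h3 := hasMellin_sub h1.1 h2.1
  rw [h1.2, h2.2] at h3
  have e : 1 / s - 1 / (s + 1) = 1 / (s * (s + 1)) := by
    have : s ≠ 0 := by rintro rfl; simp at hs
    have : s + 1 ≠ 0 := by
      intro h
      have := congrArg Complex.re h
      simp at this; linarith
    field_simp
    ring
  rw [e] at h3
  exact h3

lemma norm_one_div_mul_add_one_le {σ : ℝ} (hσ : 1 ≤ σ) (t : ℝ) :
    ‖1 / ((σ + t * Complex.I : ℂ) * (σ + t * Complex.I + 1))‖ ≤ (1 + t ^ 2)⁻¹ := by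
  have h1 : √(1 + t ^ 2) ≤ ‖(σ + t * Complex.I : ℂ)‖ := by
    rw [Complex.norm_add_mul_I]
    gcongr
    nlinarith
  have h2 : √(1 + t ^ 2) ≤ ‖(σ + t * Complex.I + 1 : ℂ)‖ := by
    rw [show (σ + t * Complex.I + 1 : ℂ) = ((σ + 1 : ℝ) : ℂ) + t * Complex.I by push_cast; ring,
      Complex.norm_add_mul_I]
    gcongr
    nlinarith
  rw [norm_div, norm_one, norm_mul, one_div]
  have h3 : (1 + t ^ 2) = √(1 + t ^ 2) * √(1 + t ^ 2) :=
    (Real.mul_self_sqrt (by positivity)).symm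
  rw [h3]
  have : 0 < √(1 + t ^ 2) := by positivity
  gcongr

lemma ofReal_add_mul_I_ne_zero {σ : ℝ} (hσ : 0 < σ) (t : ℝ) : (σ + t * Complex.I : ℂ) ≠ 0 := by
  intro h
  have := congrArg Complex.re h
  simp at this; linarith

lemma continuous_one_div_mul_add_one {σ : ℝ} (hσ : 1 ≤ σ) :
    Continuous fun t : ℝ ↦ 1 / ((σ + t * Complex.I : ℂ) * (σ + t * Complex.I + 1)) := by
  refine Continuous.div continuous_const (by fun_prop) fun t ↦ ?_
  refine mul_ne_zero (ofReal_add_mul_I_ne_zero (by linarith) t) ?_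
  have := ofReal_add_mul_I_ne_zero (σ := σ + 1) (by linarith) t
  rwa [show (((σ + 1 : ℝ) : ℂ) + t * Complex.I) = σ + t * Complex.I + 1 by push_cast; ring] at this

lemma integrable_one_div_mul_add_one {σ : ℝ} (hσ : 1 ≤ σ) :
    MeasureTheory.Integrable
      fun t : ℝ ↦ 1 / ((σ + t * Complex.I : ℂ) * (σ + t * Complex.I + 1)) := by
  refine integrable_inv_one_add_sq.mono' (continuous_one_div_mul_add_one hσ).aestronglyMeasurable ?_
  exact Filter.Eventually.of_forall (norm_one_div_mul_add_one_le hσ)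

lemma integral_eq_cesaroKernel {σ u : ℝ} (hσ : 1 ≤ σ) (hu : 0 < u) :
    (1 / (2 * π) : ℝ) • ∫ t : ℝ, (u : ℂ) ^ (-(σ + t * Complex.I : ℂ)) *
      (1 / ((σ + t * Complex.I : ℂ) * (σ + t * Complex.I + 1))) = cesaroKernel u := by
  have hm : ∀ t : ℝ, mellin cesaroKernel (σ + t * Complex.I) =
      1 / ((σ + t * Complex.I : ℂ) * (σ + t * Complex.I + 1)) := fun t ↦
    (hasMellin_cesaroKernel (s := σ + t * Complex.I) (by simp; linarith)).2
  have hc : ContinuousAt cesaroKernel u := by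
    have : (fun v : ℝ ↦ ((max (1 - v) 0 : ℝ) : ℂ)) =ᶠ[nhds u] cesaroKernel := by
      filter_upwards [lt_mem_nhds hu] with v hv
      exact (cesaroKernel_of_pos hv).symm
    refine ContinuousAt.congr ?_ this
    fun_prop
  have hV : Complex.VerticalIntegrable (mellin cesaroKernel) σ := by
    rw [Complex.VerticalIntegrable]
    simp_rw [hm]
    exact integrable_one_div_mul_add_one hσ
  have := mellinInv_mellin_eq σ cesaroKernel hu
    (hasMellin_cesaroKernel (s := σ) (by simp; linarith)).1 hV hc
  rw [mellinInv] at this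
  simp_rw [hm] at this
  exact this

lemma norm_term_add_mul_I (a : ℕ → ℂ) (σ t : ℝ) (n : ℕ) :
    ‖LSeries.term a (σ + t * Complex.I) n‖ = ‖LSeries.term a σ n‖ := by
  rw [LSeries.norm_term_eq, LSeries.norm_term_eq]
  simp

lemma continuous_term_add_mul_I (a : ℕ → ℂ) (σ : ℝ) (n : ℕ) :
    Continuous fun t : ℝ ↦ LSeries.term a (σ + t * Complex.I) n := by
  rcases eq_or_ne n 0 with rfl | hn
  · simpa using continuous_const
  · simp_rw [LSeries.term_of_ne_zero hn]
    have : (n : ℂ) ≠ 0 := by exact_mod_cast hn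
    refine Continuous.div continuous_const ?_ fun t ↦ ?_
    · exact Continuous.const_cpow (by fun_prop) (Or.inl this)
    · simp [Complex.cpow_eq_zero_iff, this]

/-- Perron's formula with the Cesàro kernel. -/
lemma sum_mul_one_sub_div_eq_integral {a : ℕ → ℂ} {σ x : ℝ} (hσ : 1 ≤ σ) (hx : 0 < x)
    (ha : LSeriesSummable a σ) :
    ∑ n ∈ Finset.Icc 1 ⌊x⌋₊, a n * (1 - n / x : ℝ) =
      (1 / (2 * π) : ℝ) • ∫ t : ℝ, LSeries a (σ + t * Complex.I) *
        ((x : ℂ) ^ (σ + t * Complex.I : ℂ) *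
          (1 / ((σ + t * Complex.I : ℂ) * (σ + t * Complex.I + 1)))) := by
  have hx0 : (x : ℂ) ≠ 0 := by exact_mod_cast hx.ne'
  set k : ℝ → ℂ := fun t ↦ 1 / ((σ + t * Complex.I : ℂ) * (σ + t * Complex.I + 1)) with hk
  have hki : MeasureTheory.Integrable k := integrable_one_div_mul_add_one hσ
  have hkc : Continuous k := continuous_one_div_mul_add_one hσ
  set F : ℕ → ℝ → ℂ := fun n t ↦ LSeries.term a (σ + t * Complex.I) n *
    ((x : ℂ) ^ (σ + t * Complex.I : ℂ) * k t) with hF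
  have hxc : Continuous fun t : ℝ ↦ (x : ℂ) ^ (σ + t * Complex.I : ℂ) :=
    Continuous.const_cpow (by fun_prop) (Or.inl hx0)
  have hn : ∀ n t, ‖F n t‖ = ‖LSeries.term a σ n‖ * x ^ σ * ‖k t‖ := by
    intro n t
    rw [hF]
    simp only [norm_mul, norm_term_add_mul_I, Complex.norm_cpow_eq_rpow_re_of_pos hx]
    simp [mul_assoc]
  have hFi : ∀ n, MeasureTheory.Integrable (F n) := by
    intro n
    refine (hki.norm.const_mul (‖LSeries.term a σ n‖ * x ^ σ)).mono'
      ((continuous_term_add_mul_I a σ n).mul (hxc.mul hkc)).aestronglyMeasurable ?_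
    exact Filter.Eventually.of_forall fun t ↦ (hn n t).le
  have hsum : Summable fun n ↦ ∫ t, ‖F n t‖ := by
    simp_rw [hn, MeasureTheory.integral_const_mul, mul_assoc]
    exact ha.norm.mul_right _
  have hS := (MeasureTheory.hasSum_integral_of_summable_integral_norm hFi hsum).const_smul
    (1 / (2 * π) : ℝ)
  have hterm : ∀ n, (1 / (2 * π) : ℝ) • ∫ t, F n t =
      if n = 0 then 0 else a n * cesaroKernel (n / x) := by
    intro n
    split_ifs with h0
    · simp [hF, h0]
    · have hn0 : (0 : ℝ) < n := by positivity
      rw [← integral_eq_cesaroKernel hσ (u := n / x) (by positivity), mul_smul_comm,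
        ← MeasureTheory.integral_const_mul]
      congr 2
      ext t
      simp only [hF, LSeries.term_of_ne_zero h0]
      rw [Complex.ofReal_div, Complex.cpow_neg, ← Complex.ofReal_div,
        Complex.ofReal_div, Complex.div_cpow_ofReal_nonneg hn0.le hx.le]
      have : ((n : ℝ) : ℂ) ^ (σ + t * Complex.I : ℂ) ≠ 0 := by
        simp [Complex.cpow_eq_zero_iff, h0]
      have h2 : (x : ℂ) ^ (σ + t * Complex.I : ℂ) ≠ 0 := by
        simp [Complex.cpow_eq_zero_iff, hx0]
      simp only [hk]
      push_cast at this ⊢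
      field_simp
  simp_rw [hterm] at hS
  have hfin := hasSum_sum_of_ne_finset_zero (L := .unconditional ℕ)
    (f := fun n : ℕ ↦ if n = 0 then 0 else a n * cesaroKernel (n / x))
    (s := Finset.Icc 1 ⌊x⌋₊) (by
      intro n hnm
      split_ifs with h0
      · rfl
      · have h1 : x < n := by
          by_contra! h
          exact hnm (Finset.mem_Icc.2 ⟨Nat.one_le_iff_ne_zero.2 h0, Nat.le_floor h⟩)
        have : 1 < n / x := by rwa [one_lt_div hx]
        rw [cesaroKernel_of_pos (by linarith), max_eq_right (by linarith)]
        simp)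
  have heq := hfin.unique hS
  refine Eq.trans (Finset.sum_congr rfl fun n hnm ↦ ?_) (heq.trans ?_)
  · obtain ⟨h1, h2⟩ := Finset.mem_Icc.1 hnm
    have h3 : (n : ℝ) ≤ x := (Nat.le_floor_iff hx.le).1 h2
    have h4 : (0 : ℝ) < n := by exact_mod_cast h1
    rw [if_neg (by omega), cesaroKernel_of_pos (by positivity), max_eq_left]
    have := (div_le_one hx).2 h3
    linarith
  · congr 2
    ext t
    simp only [hF, LSeries, tsum_mul_right]
    rfl

lemma exists_norm_sum_mul_one_sub_div_le : ∃ C : ℝ, 0 ≤ C ∧ ∀ (a : ℕ → ℂ) (σ x K : ℝ), 1 ≤ σ →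
    0 < x → LSeriesSummable a σ →
    (∀ t : ℝ, ‖LSeries a (σ + t * Complex.I)‖ ≤ K * (1 + |t|) ^ (1 / 2 : ℝ)) →
    ‖∑ n ∈ Finset.Icc 1 ⌊x⌋₊, a n * (1 - n / x : ℝ)‖ ≤ C * K * x ^ σ := by
  have hI : MeasureTheory.Integrable fun t : ℝ ↦ (1 + ‖t‖) ^ (-(3 / 2) : ℝ) :=
    integrable_one_add_norm (by simp; norm_num)
  refine ⟨(1 / (2 * π)) * (2 * ∫ t : ℝ, (1 + ‖t‖) ^ (-(3 / 2) : ℝ)), ?_, ?_⟩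
  · have : 0 ≤ ∫ t : ℝ, (1 + ‖t‖) ^ (-(3 / 2) : ℝ) :=
      MeasureTheory.integral_nonneg fun t ↦ by positivity
    positivity
  intro a σ x K hσ hx ha hK
  have hK0 : 0 ≤ K := by
    have := (norm_nonneg _).trans (hK 0)
    simpa using this
  rw [sum_mul_one_sub_div_eq_integral hσ hx ha, norm_smul, Real.norm_of_nonneg (by positivity)]
  have : ‖∫ t : ℝ, LSeries a (σ + t * Complex.I) * ((x : ℂ) ^ (σ + t * Complex.I : ℂ) *
          (1 / ((σ + t * Complex.I : ℂ) * (σ + t * Complex.I + 1))))‖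
      ≤ ∫ t : ℝ, (2 * K * x ^ σ) * (1 + ‖t‖) ^ (-(3 / 2) : ℝ) := by
    refine MeasureTheory.norm_integral_le_of_norm_le (hI.const_mul _)
      (Filter.Eventually.of_forall fun t ↦ ?_)
    rw [norm_mul, norm_mul, Complex.norm_cpow_eq_rpow_re_of_pos hx]
    have h1 := norm_one_div_mul_add_one_le hσ t
    have h2 : (1 + t ^ 2)⁻¹ ≤ 2 * (1 + |t|) ^ (-2 : ℝ) := by
      rw [Real.rpow_neg (by positivity), Real.rpow_two, inv_le_comm₀ (by positivity)
        (by positivity), mul_inv, inv_inv]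
      nlinarith [sq_abs t, sq_nonneg (|t| - 1)]
    have h3 : (1 + |t|) ^ (-(3 / 2) : ℝ) = (1 + |t|) ^ (1 / 2 : ℝ) * (1 + |t|) ^ (-2 : ℝ) := by
      rw [← Real.rpow_add (by positivity)]; norm_num
    rw [Real.norm_eq_abs, h3]
    calc _ ≤ (K * (1 + |t|) ^ (1 / 2 : ℝ)) * (x ^ σ * (2 * (1 + |t|) ^ (-2 : ℝ))) := by
          have : (σ + t * Complex.I : ℂ).re = σ := by simp
          rw [this]
          gcongr
          · exact hK t
          · exact h1.trans h2
      _ = _ := by ring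
  rw [MeasureTheory.integral_const_mul] at this
  calc _ ≤ _ := mul_le_mul_of_nonneg_left this (by positivity)
    _ = _ := by ring

/-- The Dirichlet coefficients `(Λ n - 1) * log n ^ 2`. -/
noncomputable def vonMangoldtDiff (n : ℕ) : ℝ :=
  (ArithmeticFunction.vonMangoldt n - 1) * Real.log n ^ 2

lemma LSeriesSummable_vonMangoldt_sub_one {s : ℂ} (hs : 1 < s.re) :
    LSeriesSummable ((fun n ↦ (ArithmeticFunction.vonMangoldt n : ℂ)) - 1) s :=
  (ArithmeticFunction.LSeriesSummable_vonMangoldt hs).sub (LSeriesSummable_one_iff.2 hs)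

lemma abscissaOfAbsConv_vonMangoldt_sub_one :
    LSeries.abscissaOfAbsConv ((fun n ↦ (ArithmeticFunction.vonMangoldt n : ℂ)) - 1) ≤ 1 :=
  LSeries.abscissaOfAbsConv_le_of_forall_lt_LSeriesSummable fun y hy ↦
    LSeriesSummable_vonMangoldt_sub_one (by simpa using hy)

lemma logMul_iterate_vonMangoldt_sub_one :
    LSeries.logMul^[2] ((fun n ↦ (ArithmeticFunction.vonMangoldt n : ℂ)) - 1)
      = fun n ↦ (vonMangoldtDiff n : ℂ) := by
  ext n
  simp [LSeries.logMul, vonMangoldtDiff, Complex.natCast_log]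
  ring

lemma LSeries_vonMangoldtDiff {s : ℂ} (hs : 1 < s.re) :
    LSeriesSummable (fun n ↦ (vonMangoldtDiff n : ℂ)) s ∧
    LSeries (fun n ↦ (vonMangoldtDiff n : ℂ)) s = iteratedDeriv 2 zetaDiff s := by
  have habs : LSeries.abscissaOfAbsConv ((fun n ↦ (ArithmeticFunction.vonMangoldt n : ℂ)) - 1)
      < s.re := abscissaOfAbsConv_vonMangoldt_sub_one.trans_lt (by exact_mod_cast hs)
  rw [← logMul_iterate_vonMangoldt_sub_one]
  constructor
  · refine LSeriesSummable_of_abscissaOfAbsConv_lt_re ?_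
    rwa [LSeries.absicssaOfAbsConv_logPowMul]
  · have := LSeries_iteratedDeriv 2 habs
    rw [neg_one_sq, one_mul] at this
    rw [← this]
    refine Filter.EventuallyEq.iteratedDeriv_eq 2 ?_
    filter_upwards [(isOpen_lt continuous_const Complex.continuous_re).mem_nhds hs] with w hw
    rw [LSeries_sub (ArithmeticFunction.LSeriesSummable_vonMangoldt hw)
      (LSeriesSummable_one_iff.2 hw), zetaDiff,
      ArithmeticFunction.LSeries_vonMangoldt_eq_deriv_riemannZeta_div hw,
      LSeries_one_eq_riemannZeta hw]

lemma exists_abs_sum_vonMangoldtDiff_mul_sub_le : ∃ C : ℝ, 0 ≤ C ∧ ∀ x : ℝ, 3 ≤ x →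
    |∑ n ∈ Finset.Icc 1 ⌊x⌋₊, vonMangoldtDiff n * (x - n)| ≤ C * x ^ 2 := by
  obtain ⟨K, hK⟩ := exists_norm_iteratedDeriv_zetaDiff_le
  obtain ⟨C, hC0, hC⟩ := exists_norm_sum_mul_one_sub_div_le
  have hK0 : 0 ≤ K := by
    have := (norm_nonneg _).trans (hK 2 (by simp) (by simp))
    simpa using this
  refine ⟨C * K * Real.exp 1, by positivity, fun x hx ↦ ?_⟩
  have hx0 : 0 < x := by linarith
  have hlog : 1 < Real.log x := by
    rw [Real.lt_log_iff_exp_lt hx0]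
    exact Real.exp_one_lt_d9.trans (by linarith)
  set σ : ℝ := 1 + 1 / Real.log x with hσ
  have hσ1 : 1 < σ := by
    have : 0 < 1 / Real.log x := by positivity
    linarith
  have hσ2 : σ ≤ 2 := by
    have : 1 / Real.log x ≤ 1 := by rw [div_le_one (by linarith)]; exact hlog.le
    linarith
  have h := hC (fun n ↦ (vonMangoldtDiff n : ℂ)) σ x K hσ1.le hx0
    (LSeries_vonMangoldtDiff (by simpa using hσ1)).1 (by
      intro t
      rw [(LSeries_vonMangoldtDiff (by simpa using hσ1)).2]
      simpa using hK (σ + t * Complex.I) (by simpa using hσ1) (by simpa using hσ2))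
  have hxs : x ^ σ = x * Real.exp 1 := by
    rw [hσ, Real.rpow_add hx0, Real.rpow_one, Real.rpow_def_of_pos hx0 (1 / Real.log x)]
    congr 2
    field_simp
  rw [hxs] at h
  have h2 : ∑ n ∈ Finset.Icc 1 ⌊x⌋₊, (vonMangoldtDiff n : ℂ) * (1 - n / x : ℝ) =
      ((∑ n ∈ Finset.Icc 1 ⌊x⌋₊, vonMangoldtDiff n * (1 - n / x) : ℝ) : ℂ) := by
    push_cast; rfl
  rw [h2, Complex.norm_real, Real.norm_eq_abs] at h
  have h3 : ∑ n ∈ Finset.Icc 1 ⌊x⌋₊, vonMangoldtDiff n * (x - n) =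
      x * ∑ n ∈ Finset.Icc 1 ⌊x⌋₊, vonMangoldtDiff n * (1 - n / x) := by
    rw [Finset.mul_sum]
    refine Finset.sum_congr rfl fun n _ ↦ ?_
    field_simp
  rw [h3, abs_mul, abs_of_pos hx0]
  calc _ ≤ x * (C * K * (x * Real.exp 1)) := mul_le_mul_of_nonneg_left h hx0.le
    _ = _ := by ring

/-- Summatory function `∑ n ≤ x, f n`. -/
noncomputable def summatory (f : ℕ → ℝ) (x : ℝ) : ℝ := ∑ n ∈ Finset.Icc 1 ⌊x⌋₊, f n

/-- Integrated summatory function `∑ n ≤ x, f n * (x - n)`. -/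
noncomputable def summatoryInt (f : ℕ → ℝ) (x : ℝ) : ℝ :=
  ∑ n ∈ Finset.Icc 1 ⌊x⌋₊, f n * (x - n)

lemma sum_Icc_add_sum_Ioc (g : ℕ → ℝ) {a b : ℕ} (hab : a ≤ b) :
    ∑ n ∈ Finset.Icc 1 b, g n = ∑ n ∈ Finset.Icc 1 a, g n + ∑ n ∈ Finset.Ioc a b, g n := by
  rw [← Finset.sum_union]
  · congr 1
    ext n
    simp only [Finset.mem_Icc, Finset.mem_union, Finset.mem_Ioc]
    omega
  · rw [Finset.disjoint_left]
    intro n h1 h2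
    simp only [Finset.mem_Icc, Finset.mem_Ioc] at h1 h2
    omega

lemma summatoryInt_sub {f : ℕ → ℝ} (x y : ℝ) (hxy : x ≤ y) :
    summatoryInt f y - summatoryInt f x = (y - x) * summatory f x
      + ∑ n ∈ Finset.Ioc ⌊x⌋₊ ⌊y⌋₊, f n * (y - n) := by
  rw [summatoryInt, summatoryInt, sum_Icc_add_sum_Ioc _ (Nat.floor_mono hxy), summatory,
    Finset.mul_sum, add_sub_right_comm, ← Finset.sum_sub_distrib]
  congr 1
  exact Finset.sum_congr rfl fun n _ ↦ by ring

lemma mul_summatory_le {f : ℕ → ℝ} (hf : ∀ n, 0 ≤ f n) {x y : ℝ} (hx : 0 ≤ x) (hxy : x ≤ y) :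
    (y - x) * summatory f x ≤ summatoryInt f y - summatoryInt f x := by
  rw [summatoryInt_sub x y hxy]
  refine le_add_of_nonneg_right (Finset.sum_nonneg fun n hn ↦ mul_nonneg (hf n) ?_)
  have := (Nat.le_floor_iff (hx.trans hxy)).1 (Finset.mem_Ioc.1 hn).2
  linarith

lemma le_mul_summatory {f : ℕ → ℝ} (hf : ∀ n, 0 ≤ f n) {x y : ℝ} (hx : 0 ≤ x) (hxy : x ≤ y) :
    summatoryInt f y - summatoryInt f x ≤ (y - x) * summatory f y := by
  rw [summatoryInt_sub x y hxy, summatory, summatory,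
    sum_Icc_add_sum_Ioc _ (Nat.floor_mono hxy), mul_add, Finset.mul_sum (Finset.Ioc _ _)]
  refine add_le_add_right (Finset.sum_le_sum fun n hn ↦ ?_) _
  rw [mul_comm (y - x)]
  have h1 := ((Nat.floor_lt hx).1 (Finset.mem_Ioc.1 hn).1).le
  exact mul_le_mul_of_nonneg_left (by linarith) (hf n)

lemma summatory_log_sq_sub_le {x y : ℝ} (hx : 0 ≤ x) (hxy : x ≤ y) :
    summatory (fun n ↦ Real.log n ^ 2) y ≤
      summatory (fun n ↦ Real.log n ^ 2) x + (y - x + 1) * Real.log y ^ 2 := by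
  rw [summatory, summatory, sum_Icc_add_sum_Ioc _ (Nat.floor_mono hxy)]
  gcongr
  have h1 : ∀ n ∈ Finset.Ioc ⌊x⌋₊ ⌊y⌋₊, Real.log n ^ 2 ≤ Real.log y ^ 2 := by
    intro n hn
    obtain ⟨h1, h2⟩ := Finset.mem_Ioc.1 hn
    have h3 : 1 ≤ n := by omega
    have h4 := (Nat.le_floor_iff (hx.trans hxy)).1 h2
    have h5 : (1 : ℝ) ≤ n := by exact_mod_cast h3
    have := Real.log_nonneg h5
    gcongr
  refine (Finset.sum_le_card_nsmul _ _ _ h1).trans ?_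
  rw [nsmul_eq_mul, Nat.card_Ioc, Nat.cast_sub (Nat.floor_mono hxy)]
  gcongr
  have := Nat.floor_le (hx.trans hxy)
  have := Nat.lt_floor_add_one x
  linarith

lemma summatoryInt_vonMangoldt_log_sq (x : ℝ) :
    summatoryInt (fun n ↦ ArithmeticFunction.vonMangoldt n * Real.log n ^ 2) x =
      summatoryInt (fun n ↦ Real.log n ^ 2) x + summatoryInt vonMangoldtDiff x := by
  rw [summatoryInt, summatoryInt, summatoryInt, ← Finset.sum_add_distrib]
  refine Finset.sum_congr rfl fun n _ ↦ ?_
  rw [vonMangoldtDiff]; ring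

lemma two_le_log {x : ℝ} (hx : 16 ≤ x) : 2 ≤ Real.log x := by
  rw [Real.le_log_iff_exp_le (by linarith)]
  have h := Real.exp_one_lt_d9
  have h2 : Real.exp 2 = Real.exp 1 * Real.exp 1 := by rw [← Real.exp_add]; norm_num
  rw [h2]
  nlinarith [Real.exp_pos 1]

lemma exists_abs_summatory_vonMangoldtDiff_le : ∃ C : ℝ, 0 ≤ C ∧ ∀ x : ℝ, 16 ≤ x →
    |summatory vonMangoldtDiff x| ≤ C * (x * Real.log x) := by
  obtain ⟨C, hC0, hC⟩ := exists_abs_sum_vonMangoldtDiff_mul_sub_le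
  refine ⟨5 * C + 8, by positivity, fun x hx ↦ ?_⟩
  have hl := two_le_log hx
  have hl1 : Real.log x ≤ x := (Real.log_le_sub_one_of_pos (by linarith)).trans (by linarith)
  set L := Real.log x with hL
  set h := x / L with hh
  have hx0 : 0 < x := by linarith
  have hL0 : 0 < L := by linarith
  have hhL : h * L = x := by rw [hh]; field_simp
  have h1 : 1 ≤ h := by rw [hh, one_le_div hL0]; exact hl1
  have h2 : h ≤ x / 2 := by rw [hh]; gcongr
  set fL : ℕ → ℝ := fun n ↦ ArithmeticFunction.vonMangoldt n * Real.log n ^ 2 with hfL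
  set f1 : ℕ → ℝ := fun n ↦ Real.log n ^ 2 with hf1
  have hfL0 : ∀ n, 0 ≤ fL n := fun n ↦
    mul_nonneg ArithmeticFunction.vonMangoldt_nonneg (sq_nonneg _)
  have hf10 : ∀ n, 0 ≤ f1 n := fun n ↦ sq_nonneg _
  have hd : ∀ y : ℝ, summatory vonMangoldtDiff y = summatory fL y - summatory f1 y := by
    intro y
    rw [summatory, summatory, summatory, ← Finset.sum_sub_distrib]
    exact Finset.sum_congr rfl fun n _ ↦ by rw [vonMangoldtDiff]; ring
  have hM : ∀ y : ℝ, summatoryInt fL y = summatoryInt f1 y + summatoryInt vonMangoldtDiff y :=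
    summatoryInt_vonMangoldt_log_sq
  have hb0 := abs_le.1 (hC x (by linarith))
  have hb1 := abs_le.1 (hC (x + h) (by linarith))
  have hb2 := abs_le.1 (hC (x - h) (by linarith))
  change -(C * x ^ 2) ≤ summatoryInt vonMangoldtDiff x ∧
    summatoryInt vonMangoldtDiff x ≤ C * x ^ 2 at hb0
  change -(C * (x + h) ^ 2) ≤ summatoryInt vonMangoldtDiff (x + h) ∧
    summatoryInt vonMangoldtDiff (x + h) ≤ C * (x + h) ^ 2 at hb1
  change -(C * (x - h) ^ 2) ≤ summatoryInt vonMangoldtDiff (x - h) ∧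
    summatoryInt vonMangoldtDiff (x - h) ≤ C * (x - h) ^ 2 at hb2
  have hq1 : C * (x + h) ^ 2 ≤ C * (4 * x ^ 2) := by gcongr; nlinarith
  have hq2 : C * (x - h) ^ 2 ≤ C * x ^ 2 := by gcongr <;> linarith
  have hxx : C * x ^ 2 = h * (C * (x * L)) := by rw [← hhL]; ring
  have u1 := mul_summatory_le hfL0 hx0.le (show x ≤ x + h by linarith)
  have u2 := le_mul_summatory hf10 hx0.le (show x ≤ x + h by linarith)
  have u3 := summatory_log_sq_sub_le hx0.le (show x ≤ x + h by linarith)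
  have v1 := le_mul_summatory hfL0 (show 0 ≤ x - h by linarith) (show x - h ≤ x by linarith)
  have v2 := mul_summatory_le hf10 (show 0 ≤ x - h by linarith) (show x - h ≤ x by linarith)
  have v3 := summatory_log_sq_sub_le (show 0 ≤ x - h by linarith) (show x - h ≤ x by linarith)
  rw [hM, hM] at u1 v1
  have e1 : x + h - x = h := by ring
  have e2 : x - (x - h) = h := by ring
  rw [e1] at u1 u2 u3
  rw [e2] at v1 v2 v3
  have hlog : Real.log (x + h) ≤ 2 * L := by
    calc Real.log (x + h) ≤ Real.log (x * x) := Real.log_le_log (by linarith) (by nlinarith)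
      _ = 2 * L := by rw [Real.log_mul hx0.ne' hx0.ne']; ring
  have hlog0 : 0 ≤ Real.log (x + h) := Real.log_nonneg (by linarith)
  have w1 : (h + 1) * Real.log (x + h) ^ 2 ≤ 8 * (x * L) := by
    calc _ ≤ (2 * h) * (2 * L) ^ 2 := by gcongr; linarith
      _ = 8 * (h * L * L) := by ring
      _ = 8 * (x * L) := by rw [hhL]
  have w2 : (h + 1) * L ^ 2 ≤ 8 * (x * L) := by
    calc _ ≤ (8 * h) * L ^ 2 := by gcongr; linarith
      _ = 8 * (h * L * L) := by ring
      _ = 8 * (x * L) := by rw [hhL]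
  have hh0 : 0 < h := by linarith
  rw [hd, abs_le]
  constructor
  · have k1 : h * (summatory f1 (x - h)) ≤ h * (summatory fL x + 2 * (C * (x * L))) := by
      rw [mul_add]
      linarith
    have k2 := le_of_mul_le_mul_left k1 hh0
    have k3 : 0 ≤ C * (x * L) := by positivity
    linarith
  · have k1 : h * (summatory fL x) ≤ h * (summatory f1 (x + h) + 5 * (C * (x * L))) := by
      rw [mul_add]
      linarith
    have k2 := le_of_mul_le_mul_left k1 hh0
    linarith

lemma sum_mul_log_div_le {f : ℕ → ℝ} {C : ℝ}
    (hC : ∀ N : ℕ, ∑ n ∈ Finset.Icc 1 N, f n ≤ C * N) (hf : ∀ n, 0 ≤ f n) (N : ℕ) :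
    ∑ n ∈ Finset.Icc 1 N, f n * (Real.log (N + 1) - Real.log n) ≤ C * N := by
  induction N with
  | zero => simp
  | succ N ih =>
    have h1 : ∑ n ∈ Finset.Icc 1 (N + 1), f n * (Real.log ((N + 1 : ℕ) + 1) - Real.log n) =
        ∑ n ∈ Finset.Icc 1 (N + 1), f n * (Real.log (N + 1) - Real.log n) +
        (Real.log ((N + 1 : ℕ) + 1) - Real.log (N + 1)) * ∑ n ∈ Finset.Icc 1 (N + 1), f n := by
      rw [Finset.mul_sum, ← Finset.sum_add_distrib]
      exact Finset.sum_congr rfl fun n _ ↦ by ring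
    have h2 : ∑ n ∈ Finset.Icc 1 (N + 1), f n * (Real.log (N + 1) - Real.log n) =
        ∑ n ∈ Finset.Icc 1 N, f n * (Real.log (N + 1) - Real.log n) := by
      rw [Finset.sum_Icc_succ_top (by omega)]
      push_cast; ring
    have hpos : (0 : ℝ) < N + 1 := by positivity
    have h3 : Real.log ((N + 1 : ℕ) + 1) - Real.log (N + 1) ≤ 1 / (N + 1) := by
      rw [← Real.log_div (by positivity) (by positivity)]
      refine (Real.log_le_sub_one_of_pos (by positivity)).trans (le_of_eq ?_)
      push_cast
      field_simp
      ring
    have h4 := hC (N + 1)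
    have h5 : 0 ≤ ∑ n ∈ Finset.Icc 1 (N + 1), f n := Finset.sum_nonneg fun n _ ↦ hf n
    have h6 : (Real.log ((N + 1 : ℕ) + 1) - Real.log (N + 1)) * ∑ n ∈ Finset.Icc 1 (N + 1), f n
        ≤ 1 / (N + 1) * (C * (N + 1)) := by
      push_cast at h3 h4 ⊢
      gcongr
    have h7 : 1 / ((N : ℝ) + 1) * (C * (N + 1)) = C := by field_simp
    rw [h1, h2]
    push_cast at h6 ⊢
    linarith

lemma sum_vonMangoldt_add_one_le (N : ℕ) :
    ∑ n ∈ Finset.Icc 1 N, (ArithmeticFunction.vonMangoldt n + 1) ≤ (Real.log 4 + 5) * N := by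
  have h := Chebyshev.psi_le_const_mul_self (Nat.cast_nonneg N)
  rw [Chebyshev.psi, Nat.floor_natCast] at h
  rw [Finset.sum_add_distrib]
  have : Finset.Icc 1 N = Finset.Ioc 0 N := by ext; simp [Nat.succ_le_iff]
  simp only [Finset.sum_const, Nat.card_Ioc, nsmul_eq_mul, mul_one, Nat.sub_zero, this]
  linarith

lemma exists_abs_psi_sub_floor_le : ∃ C : ℝ, 0 ≤ C ∧ ∀ x : ℝ, 16 ≤ x →
    |Chebyshev.psi x - ⌊x⌋₊| ≤ C * (x / Real.log x) := by
  obtain ⟨C, hC0, hC⟩ := exists_abs_summatory_vonMangoldtDiff_le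
  refine ⟨C + 2 * (Real.log 4 + 5), by positivity, fun x hx ↦ ?_⟩
  have hx0 : 0 < x := by linarith
  have hl := two_le_log hx
  set L := Real.log x with hL
  set N := ⌊x⌋₊ with hN
  have hNx : (N : ℝ) ≤ x := Nat.floor_le hx0.le
  have hxN : x < N + 1 := Nat.lt_floor_add_one x
  have hpsi : Chebyshev.psi x - N =
      ∑ n ∈ Finset.Icc 1 N, (ArithmeticFunction.vonMangoldt n - 1) := by
    have : Finset.Icc 1 N = Finset.Ioc 0 N := by ext; simp [Nat.succ_le_iff]
    rw [Chebyshev.psi, Finset.sum_sub_distrib, this]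
    simp [hN]
  have hsplit : L ^ 2 * (Chebyshev.psi x - N) = summatory vonMangoldtDiff x +
      ∑ n ∈ Finset.Icc 1 N,
        (ArithmeticFunction.vonMangoldt n - 1) * (L ^ 2 - Real.log n ^ 2) := by
    rw [hpsi, summatory, Finset.mul_sum, ← Finset.sum_add_distrib]
    exact Finset.sum_congr rfl fun n _ ↦ by rw [vonMangoldtDiff]; ring
  have hbound : |∑ n ∈ Finset.Icc 1 N,
      (ArithmeticFunction.vonMangoldt n - 1) * (L ^ 2 - Real.log n ^ 2)| ≤
      2 * L * ((Real.log 4 + 5) * x) := by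
    have h1 := sum_mul_log_div_le sum_vonMangoldt_add_one_le
      (fun n ↦ add_nonneg ArithmeticFunction.vonMangoldt_nonneg zero_le_one) N
    have h2 : (Real.log 4 + 5) * N ≤ (Real.log 4 + 5) * x := by gcongr
    refine (Finset.abs_sum_le_sum_abs _ _).trans ?_
    refine le_trans ?_ (mul_le_mul_of_nonneg_left (h1.trans h2) (by linarith))
    rw [Finset.mul_sum]
    refine Finset.sum_le_sum fun n hn ↦ ?_
    obtain ⟨hn1, hn2⟩ := Finset.mem_Icc.1 hn
    have hn1' : (1 : ℝ) ≤ n := by exact_mod_cast hn1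
    have hn2' : (n : ℝ) ≤ x := (Nat.le_floor_iff hx0.le).1 hn2
    have l0 : 0 ≤ Real.log n := Real.log_nonneg hn1'
    have l1 : Real.log n ≤ L := Real.log_le_log (by linarith) hn2'
    have l2 : L ≤ Real.log (N + 1) := Real.log_le_log hx0 hxN.le
    have hv : 0 ≤ ArithmeticFunction.vonMangoldt n := ArithmeticFunction.vonMangoldt_nonneg
    rw [abs_mul]
    have a1 : |ArithmeticFunction.vonMangoldt n - 1| ≤ ArithmeticFunction.vonMangoldt n + 1 := by
      rw [abs_le]; constructor <;> linarith
    have a2 : |L ^ 2 - Real.log n ^ 2| ≤ 2 * L * (Real.log (N + 1) - Real.log n) := by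
      rw [abs_of_nonneg (by nlinarith)]
      nlinarith
    calc _ ≤ (ArithmeticFunction.vonMangoldt n + 1) * (2 * L * (Real.log (N + 1) - Real.log n)) :=
          mul_le_mul a1 a2 (abs_nonneg _) (by linarith)
      _ = _ := by ring
  have hfin : L ^ 2 * |Chebyshev.psi x - N| ≤
      L ^ 2 * ((C + 2 * (Real.log 4 + 5)) * (x / L)) := by
    have e : L ^ 2 * ((C + 2 * (Real.log 4 + 5)) * (x / L)) =
        C * (x * L) + 2 * L * ((Real.log 4 + 5) * x) := by
      field_simp
    have e' : L ^ 2 * |Chebyshev.psi x - N| = |L ^ 2 * (Chebyshev.psi x - N)| := by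
      rw [abs_mul, abs_of_nonneg (sq_nonneg L)]
    rw [e, e', hsplit]
    exact (abs_add_le _ _).trans (add_le_add (hC x hx) hbound)
  exact le_of_mul_le_mul_left hfin (by positivity)

/-- The prime number theorem with a logarithmic saving, for the Chebyshev function `θ`. -/
lemma exists_abs_theta_sub_le : ∃ C : ℝ, 0 ≤ C ∧ ∀ x : ℝ, 16 ≤ x →
    |Chebyshev.theta x - x| ≤ C * (x / Real.log x) := by
  obtain ⟨C, hC0, hC⟩ := exists_abs_psi_sub_floor_le
  refine ⟨C + 33, by positivity, fun x hx ↦ ?_⟩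
  have hx0 : 0 < x := by linarith
  have hl := two_le_log hx
  have h1 := abs_le.1 (hC x hx)
  have h2 := abs_le.1 (Chebyshev.abs_psi_sub_theta_le_sqrt_mul_log (x := x) (by linarith))
  have h3 : Real.log x ≤ x := (Real.log_le_sub_one_of_pos hx0).trans (by linarith)
  have h4 : 1 ≤ x / Real.log x := by rw [one_le_div (by linarith)]; exact h3
  have h5 := Nat.floor_le hx0.le
  have h6 := Nat.lt_floor_add_one x
  have h7 : 2 * √x * Real.log x ≤ 32 * (x / Real.log x) := by
    have e1 : Real.log x ≤ 4 * √(√x) := by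
      have : Real.log x = 4 * Real.log (√(√x)) := by
        rw [Real.log_sqrt (by positivity), Real.log_sqrt (by positivity)]; ring
      rw [this]
      have := Real.log_le_sub_one_of_pos (show 0 < √(√x) by positivity)
      linarith
    have e2 : Real.log x ^ 2 ≤ 16 * √x := by
      calc Real.log x ^ 2 ≤ (4 * √(√x)) ^ 2 := by gcongr
        _ = 16 * √x := by rw [mul_pow, Real.sq_sqrt (by positivity)]; norm_num
    rw [← mul_div_assoc, le_div_iff₀ (by linarith)]
    calc 2 * √x * Real.log x * Real.log x = 2 * √x * Real.log x ^ 2 := by ring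
      _ ≤ 2 * √x * (16 * √x) := by gcongr
      _ = 32 * (√x * √x) := by ring
      _ = 32 * x := by rw [Real.mul_self_sqrt hx0.le]
  rw [abs_le]
  constructor <;> linarith

lemma hasDerivAt_div_log_sq_add (K : ℝ) {t : ℝ} (ht : 1 < t) :
    HasDerivAt (fun t ↦ t / Real.log t ^ 2 + K * (t / Real.log t ^ 3))
      (1 / Real.log t ^ 2 + (K - 2) / Real.log t ^ 3 - 3 * K / Real.log t ^ 4) t := by
  have hl := (Real.log_pos ht).ne'
  have ht0 : t ≠ 0 := by linarith
  have hlog := Real.hasDerivAt_log ht0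
  have h2 := (hasDerivAt_id t).div (hlog.pow 2) (pow_ne_zero 2 hl)
  have h3 := ((hasDerivAt_id t).div (hlog.pow 3) (pow_ne_zero 3 hl)).const_mul K
  refine (h2.add h3).congr_deriv ?_
  simp only [id, Pi.pow_apply]
  field_simp
  push_cast
  ring

lemma continuousOn_div_log_sq_add_deriv (K : ℝ) :
    ContinuousOn (fun t ↦ 1 / Real.log t ^ 2 + (K - 2) / Real.log t ^ 3
      - 3 * K / Real.log t ^ 4) (Set.Ioi 1) := by
  intro t ht
  have hl := (Real.log_pos ht).ne'
  have ht0 : t ≠ 0 := by have : 1 < t := ht; linarith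
  refine ContinuousAt.continuousWithinAt ?_
  have h2 := pow_ne_zero 2 hl
  have h3 := pow_ne_zero 3 hl
  have h4 := pow_ne_zero 4 hl
  fun_prop

lemma intervalIntegrable_theta_div {a b : ℝ} (ha : 2 ≤ a) (hab : a ≤ b) :
    IntervalIntegrable (fun t ↦ Chebyshev.theta t / (t * Real.log t ^ 2))
      MeasureTheory.volume a b := by
  rw [intervalIntegrable_iff_integrableOn_Icc_of_le hab]
  exact (Chebyshev.integrableOn_theta_div_id_mul_log_sq b).mono_set
    (Set.Icc_subset_Icc ha le_rfl)

lemma exists_integral_theta_div_le : ∃ K c x₀ : ℝ, 0 ≤ K ∧ ∀ x : ℝ, x₀ ≤ x →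
    ∫ t in (2 : ℝ)..x, Chebyshev.theta t / (t * Real.log t ^ 2) ≤
      x / Real.log x ^ 2 + K * (x / Real.log x ^ 3) + c := by
  obtain ⟨C, hC0, hC⟩ := exists_abs_theta_sub_le
  set x₀ : ℝ := max 16 (Real.exp 6) with hx₀
  set K : ℝ := 2 * C + 4 with hK
  have h16 : 16 ≤ x₀ := le_max_left _ _
  refine ⟨K, ∫ t in (2 : ℝ)..x₀, Chebyshev.theta t / (t * Real.log t ^ 2), x₀, by positivity,
    fun x hx ↦ ?_⟩
  rw [← intervalIntegral.integral_add_adjacent_intervals (b := x₀)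
    (intervalIntegrable_theta_div le_rfl (by linarith))
    (intervalIntegrable_theta_div (by linarith) hx), add_comm]
  gcongr
  set F : ℝ → ℝ := fun t ↦ t / Real.log t ^ 2 + K * (t / Real.log t ^ 3) with hF
  set F' : ℝ → ℝ := fun t ↦ 1 / Real.log t ^ 2 + (K - 2) / Real.log t ^ 3
      - 3 * K / Real.log t ^ 4 with hF'
  have hFint : IntervalIntegrable F' MeasureTheory.volume x₀ x := by
    refine ((continuousOn_div_log_sq_add_deriv K).mono ?_).intervalIntegrable
    rw [Set.uIcc_of_le hx]
    intro t ht
    have : x₀ ≤ t := ht.1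
    change 1 < t
    linarith
  have hftc : ∫ t in x₀..x, F' t = F x - F x₀ := by
    refine intervalIntegral.integral_eq_sub_of_hasDerivAt (fun t ht ↦ ?_) hFint
    rw [Set.uIcc_of_le hx] at ht
    have : x₀ ≤ t := ht.1
    exact hasDerivAt_div_log_sq_add K (by linarith)
  have hFx₀ : 0 ≤ F x₀ := by
    have := Real.log_nonneg (show 1 ≤ x₀ by linarith)
    rw [hF]; positivity
  have hle : ∫ t in x₀..x, Chebyshev.theta t / (t * Real.log t ^ 2) ≤ ∫ t in x₀..x, F' t := by
    refine intervalIntegral.integral_mono_on hx (intervalIntegrable_theta_div (by linarith) hx)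
      hFint fun t ht ↦ ?_
    have ht1 : x₀ ≤ t := ht.1
    have ht0 : 0 < t := by linarith
    have h6 : 6 ≤ Real.log t := by
      rw [Real.le_log_iff_exp_le ht0]
      exact (le_max_right _ _).trans ht1
    have hth : Chebyshev.theta t ≤ t + C * (t / Real.log t) := by
      have := (abs_le.1 (hC t (h16.trans ht1))).2
      linarith
    set l := Real.log t with hl
    have hl0 : 0 < l := by linarith
    have e1 : Chebyshev.theta t / (t * l ^ 2) ≤ 1 / l ^ 2 + C / l ^ 3 := by
      rw [div_le_iff₀ (by positivity)]
      refine hth.trans (le_of_eq ?_)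
      field_simp
    have e2 : F' t - (1 / l ^ 2 + C / l ^ 3) = (C + 2) * (l - 6) / l ^ 4 := by
      simp only [hF', ← hl, hK]
      field_simp
      ring
    have e3 : 0 ≤ (C + 2) * (l - 6) / l ^ 4 :=
      div_nonneg (mul_nonneg (by linarith) (by linarith)) (by positivity)
    linarith
  linarith

lemma tendsto_div_log_pow (k : ℕ) :
    Filter.Tendsto (fun x : ℝ ↦ x / Real.log x ^ k) Filter.atTop Filter.atTop := by
  have h := (Real.tendsto_exp_div_pow_atTop k).comp Real.tendsto_log_atTop
  refine h.congr' ?_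
  filter_upwards [Filter.eventually_gt_atTop 0] with x hx
  simp [Real.exp_log hx]

lemma exists_div_log_le_primeCounting : ∃ C : ℝ, 0 ≤ C ∧ ∀ᶠ x : ℝ in Filter.atTop,
    x / Real.log x ≤ Nat.primeCounting ⌊x⌋₊ * (1 + C / Real.log x) := by
  obtain ⟨C, hC0, hC⟩ := exists_abs_theta_sub_le
  refine ⟨2 * C, by positivity, ?_⟩
  filter_upwards [Filter.eventually_ge_atTop 16,
    Real.tendsto_log_atTop.eventually_ge_atTop (2 * C)] with x hx hL
  have hl := two_le_log hx
  have h1 := (abs_le.1 (hC x hx)).1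
  have h2 := Chebyshev.theta_le_pi_mul_log' x
  set L := Real.log x
  set n : ℝ := (Nat.primeCounting ⌊x⌋₊ : ℝ)
  have hL0 : 0 < L := by linarith
  have h3 : x / L * (1 - C / L) ≤ n := by
    rw [← mul_le_mul_iff_of_pos_right hL0]
    calc x / L * (1 - C / L) * L = x - C * (x / L) := by field_simp
      _ ≤ n * L := by linarith
  have h4 : C / L ≤ 1 / 2 := by rw [div_le_iff₀ hL0]; linarith
  have h5 : 0 ≤ C / L := by positivity
  have h6 : 1 ≤ (1 - C / L) * (1 + 2 * C / L) := by
    rw [show 2 * C / L = 2 * (C / L) by ring]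
    nlinarith
  have hx0 : 0 ≤ x / L := by apply div_nonneg <;> linarith
  calc x / L ≤ x / L * ((1 - C / L) * (1 + 2 * C / L)) := le_mul_of_one_le_right hx0 h6
    _ = x / L * (1 - C / L) * (1 + 2 * C / L) := by ring
    _ ≤ n * (1 + 2 * C / L) := by gcongr

lemma exists_primeCounting_mul_le_theta : ∃ C : ℝ, 0 ≤ C ∧ ∀ᶠ x : ℝ in Filter.atTop,
    Nat.primeCounting ⌊x⌋₊ * (Real.log x - 1 - C / Real.log x) ≤ Chebyshev.theta x := by
  obtain ⟨K, c, x₀, hK0, hK⟩ := exists_integral_theta_div_le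
  obtain ⟨C, hC0, hC⟩ := exists_div_log_le_primeCounting
  refine ⟨C + (K + 1) + C * (K + 1), by positivity, ?_⟩
  filter_upwards [hC, Filter.eventually_ge_atTop x₀, Filter.eventually_ge_atTop 16,
    (tendsto_div_log_pow 3).eventually_ge_atTop c] with x hCx hx hx16 hc
  have hl := two_le_log hx16
  have h1 := Chebyshev.primeCounting_eq_theta_div_log_add_integral (x := x) (by linarith)
  have h2 := hK x hx
  set L := Real.log x
  set n : ℝ := (Nat.primeCounting ⌊x⌋₊ : ℝ)
  have hL0 : 0 < L := by linarith
  have hn0 : 0 ≤ n := Nat.cast_nonneg _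
  have h3 : n * L - Chebyshev.theta x ≤ x / L * (1 + (K + 1) / L) := by
    have : n - Chebyshev.theta x / L ≤ x / L ^ 2 + (K + 1) * (x / L ^ 3) := by linarith
    have := mul_le_mul_of_nonneg_right this hL0.le
    calc n * L - Chebyshev.theta x = (n - Chebyshev.theta x / L) * L := by field_simp
      _ ≤ _ := this
      _ = _ := by field_simp
  have h4 : x / L * (1 + (K + 1) / L) ≤ n * (1 + C / L) * (1 + (K + 1) / L) := by gcongr
  have h5 : n * (1 + C / L) * (1 + (K + 1) / L) ≤
      n * (1 + (C + (K + 1) + C * (K + 1)) / L) := by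
    rw [mul_assoc]
    gcongr
    have : (1 + C / L) * (1 + (K + 1) / L) =
      1 + (C + (K + 1) + C * (K + 1) / L) / L := by field_simp; ring
    rw [this]
    gcongr
    exact div_le_self (by positivity) (by linarith)
  linarith

lemma exists_log_le_of_theta_eq : ∃ D : ℝ, 0 ≤ D ∧ ∀ᶠ x : ℝ in Filter.atTop, ∀ y : ℝ, x ≤ y →
    Chebyshev.theta y = Chebyshev.theta x → Real.log (y + 1) ≤ Real.log x + D / Real.log x := by
  obtain ⟨C, hC0, hC⟩ := exists_abs_theta_sub_le
  refine ⟨5 * C + 1, by positivity, ?_⟩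
  filter_upwards [Filter.eventually_ge_atTop 16,
    Real.tendsto_log_atTop.eventually_ge_atTop (2 * C)] with x hx hL y hxy hth
  have hl := two_le_log hx
  have hx0 : 0 < x := by linarith
  have h1 := (abs_le.1 (hC x hx)).2
  have h2 := (abs_le.1 (hC y (hx.trans hxy))).1
  have hly : Real.log x ≤ Real.log y := Real.log_le_log hx0 hxy
  have hlx : Real.log x ≤ x := (Real.log_le_sub_one_of_pos hx0).trans (by linarith)
  set L := Real.log x
  have hL0 : 0 < L := by linarith
  have h3 : C * (y / Real.log y) ≤ C * (y / L) := by gcongr; linarith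
  have h4 : C / L ≤ 1 / 2 := by rw [div_le_iff₀ hL0]; linarith
  have h5 : 0 ≤ C / L := by positivity
  have h6 : y * (1 - C / L) ≤ x * (1 + C / L) := by
    have e1 : C * (y / L) = y * (C / L) := by ring
    have e2 : C * (x / L) = x * (C / L) := by ring
    linarith
  have h7 : y ≤ x * (1 + 5 * (C / L)) := by
    set u := C / L
    have a1 : 1 ≤ (1 - u) * (1 + 2 * u) := by nlinarith
    have a2 : (1 + u) * (1 + 2 * u) ≤ 1 + 5 * u := by nlinarith
    calc y ≤ y * ((1 - u) * (1 + 2 * u)) := le_mul_of_one_le_right (by linarith) a1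
      _ = y * (1 - u) * (1 + 2 * u) := by ring
      _ ≤ x * (1 + u) * (1 + 2 * u) := by gcongr
      _ = x * ((1 + u) * (1 + 2 * u)) := by ring
      _ ≤ _ := by gcongr
  have h8 : y + 1 ≤ x * (1 + (5 * C + 1) / L) := by
    have : 1 ≤ x / L := by rwa [one_le_div hL0]
    calc y + 1 ≤ x * (1 + 5 * (C / L)) + x / L := by linarith
      _ = _ := by ring
  calc Real.log (y + 1) ≤ Real.log (x * (1 + (5 * C + 1) / L)) :=
        Real.log_le_log (by linarith) h8
    _ = L + Real.log (1 + (5 * C + 1) / L) := Real.log_mul hx0.ne' (by positivity)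
    _ ≤ _ := by
      have := Real.log_le_sub_one_of_pos (show 0 < 1 + (5 * C + 1) / L by positivity)
      linarith

lemma chebyshevTheta_eq (n : ℕ) : chebyshevTheta n = Chebyshev.theta n := by
  rw [chebyshevTheta, Chebyshev.theta_eq_sum_Icc, Nat.floor_natCast,
    Nat.range_succ_eq_Icc_zero]

lemma primeCounting_nthPrime {n : ℕ} (hn : 1 ≤ n) : Nat.primeCounting (nthPrime n) = n := by
  rw [nthPrime, Nat.primeCounting, Nat.primeCounting',
    Nat.count_nth_succ_of_infinite Nat.infinite_setOfPred_prime]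
  omega

lemma self_le_nthPrime {n : ℕ} (hn : 1 ≤ n) : n ≤ nthPrime n := by
  have := Nat.add_two_le_nth_prime (n - 1)
  rw [nthPrime]
  omega

lemma theta_nthPrime_succ_sub_one {n : ℕ} (hn : 1 ≤ n) :
    nthPrime n + 1 ≤ nthPrime (n + 1) ∧
    Chebyshev.theta ((nthPrime (n + 1) - 1 : ℕ) : ℝ) = Chebyshev.theta (nthPrime n) := by
  have hinf := Nat.infinite_setOfPred_prime
  have hlt : nthPrime n < nthPrime (n + 1) :=
    Nat.nth_strictMono hinf (by omega)
  refine ⟨hlt, ?_⟩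
  rw [Chebyshev.theta_eq_sum_Icc, Chebyshev.theta_eq_sum_Icc, Nat.floor_natCast, Nat.floor_natCast]
  congr 1
  ext r
  simp only [Finset.mem_filter, Finset.mem_Icc, zero_le, true_and, and_congr_left_iff]
  intro hr
  refine ⟨fun h ↦ ?_, fun h ↦ by omega⟩
  have h1 : r < Nat.nth Nat.Prime (n + 1 - 1) := by
    have : r < nthPrime (n + 1) := by omega
    exact this
  rw [← Nat.nth_count hr] at h1 ⊢
  have h2 := (Nat.nth_strictMono hinf).lt_iff_lt.1 h1
  exact (Nat.nth_strictMono hinf).monotone (by omega)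

/-- The lower bound for `ϑ(p_n) / log p_{n+1}` in terms of `log p_n`. -/
lemma exists_mul_le_theta_div_log : ∃ E : ℝ, 0 ≤ E ∧ ∀ᶠ n : ℕ in Filter.atTop,
    (n : ℝ) * (1 - 1 / Real.log (nthPrime n) - E / Real.log (nthPrime n) ^ 2) ≤
      chebyshevTheta (nthPrime n) / Real.log (nthPrime (n + 1)) ∧
    Real.log n + Real.log (Real.log n) - 2 ≤ Real.log (nthPrime n) := by
  obtain ⟨C, hC0, hC⟩ := exists_primeCounting_mul_le_theta
  obtain ⟨D, hD0, hD⟩ := exists_log_le_of_theta_eq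
  have htend : Filter.Tendsto (fun n : ℕ ↦ (nthPrime n : ℝ)) Filter.atTop Filter.atTop := by
    refine Filter.tendsto_atTop_mono' _ ?_ tendsto_natCast_atTop_atTop
    filter_upwards [Filter.eventually_ge_atTop 1] with n hn
    exact_mod_cast self_le_nthPrime hn
  refine ⟨C + D, by positivity, ?_⟩
  filter_upwards [htend.eventually hC, htend.eventually hD,
    htend.eventually (Filter.eventually_ge_atTop 16),
    htend.eventually (Real.tendsto_log_atTop.eventually_ge_atTop (4 + 4 * C)),
    Filter.eventually_ge_atTop 3] with n h1 h2 h16 hL hn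
  have hn1 : 1 ≤ n := by omega
  obtain ⟨hlt, hth⟩ := theta_nthPrime_succ_sub_one hn1
  have hl := two_le_log h16
  have hnp : (n : ℝ) ≤ nthPrime n := by exact_mod_cast self_le_nthPrime hn1
  rw [Nat.floor_natCast, primeCounting_nthPrime hn1] at h1
  have h3 := h2 ((nthPrime (n + 1) - 1 : ℕ) : ℝ) (by exact_mod_cast (by omega)) hth
  have h4 : ((nthPrime (n + 1) - 1 : ℕ) : ℝ) + 1 = nthPrime (n + 1) := by
    exact_mod_cast (show nthPrime (n + 1) - 1 + 1 = nthPrime (n + 1) by omega)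
  rw [h4] at h3
  have h5 : Real.log (nthPrime n) ≤ Real.log (nthPrime (n + 1)) := by
    refine Real.log_le_log (by linarith) ?_
    exact_mod_cast (show nthPrime n ≤ nthPrime (n + 1) by omega)
  have h6 := Chebyshev.theta_le_log4_mul_x (x := (nthPrime n : ℝ)) (by linarith)
  rw [chebyshevTheta_eq]
  set p : ℝ := (nthPrime n : ℝ) with hp
  set q : ℝ := (nthPrime (n + 1) : ℝ) with hq
  set L := Real.log p with hLdef
  have hL0 : 0 < L := by linarith
  have hL2 : 2 ≤ L := hl
  have hn0 : (3 : ℝ) ≤ n := by exact_mod_cast hn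
  constructor
  · rw [le_div_iff₀ (by linarith)]
    have e1 : (n : ℝ) * (1 - 1 / L - (C + D) / L ^ 2) * Real.log q ≤
        n * (L - 1 - C / L) := by
      rw [mul_assoc]
      gcongr
      rcases le_total 0 (1 - 1 / L - (C + D) / L ^ 2) with hs | hs
      · calc _ ≤ (1 - 1 / L - (C + D) / L ^ 2) * (L + D / L) := by gcongr
          _ = L - 1 - C / L - (D / L ^ 2 + (C + D) * D / L ^ 3) := by
            field_simp; ring
          _ ≤ _ := by
            have : 0 ≤ D / L ^ 2 + (C + D) * D / L ^ 3 := by positivity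
            linarith
      · have : C / L ≤ 1 / 2 := by rw [div_le_iff₀ hL0]; linarith
        have := mul_nonpos_of_nonpos_of_nonneg hs (show 0 ≤ Real.log q by linarith)
        linarith
    exact e1.trans h1
  · have hlogn : 0 < Real.log n := Real.log_pos (by linarith)
    have hlogL : Real.log n ≤ L := Real.log_le_log (by linarith) hnp
    have hCL : C / L ≤ 1 / 2 := by rw [div_le_iff₀ hL0]; linarith
    have h4log : Real.log 4 ≤ 3 / 2 := by
      have : Real.log 4 = 2 * Real.log 2 := by
        rw [show (4 : ℝ) = 2 ^ 2 by norm_num, Real.log_pow]; norm_num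
      have := Real.log_two_lt_d9
      linarith
    have a1 : n * Real.log n ≤ p * 4 := by
      have b1 : (n : ℝ) * (L / 2) ≤ n * (L - 1 - C / L) := by
        gcongr
        linarith
      have b2 : (n : ℝ) * Real.log n ≤ n * L := by gcongr
      have b3 : Real.log 4 * p ≤ 3 / 2 * p := by gcongr
      linarith
    have a2 : Real.log (n * Real.log n) ≤ Real.log (p * 4) :=
      Real.log_le_log (by positivity) a1
    rw [Real.log_mul (by positivity) hlogn.ne', Real.log_mul (by positivity) (by norm_num)] at a2
    linarith

lemma one_div_add_div_sq_le {ε E l m L : ℝ} (hE : 0 ≤ E) (hl : 0 < l) (hm : 2 ≤ m)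
    (hml : m ^ 2 ≤ l) (hmε : 3 + E ≤ ε * m) (hL : l + m - 2 ≤ L) :
    1 / L + E / L ^ 2 ≤ 1 / l - (1 - ε) * m / l ^ 2 := by
  set d := m - 2 with hd
  have hd0 : 0 ≤ d := by linarith
  have h1 : 1 / L ≤ 1 / (l + d) := by gcongr; linarith
  have h2 : E / L ^ 2 ≤ E / l ^ 2 := by gcongr; linarith
  have h3 : 1 / (l + d) ≤ 1 / l - d / l ^ 2 + d ^ 2 / l ^ 3 := by
    have : 1 / l - d / l ^ 2 + d ^ 2 / l ^ 3 - 1 / (l + d) = d ^ 3 / (l ^ 3 * (l + d)) := by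
      have : l + d ≠ 0 := by positivity
      field_simp
      ring
    have : 0 ≤ d ^ 3 / (l ^ 3 * (l + d)) := by positivity
    linarith
  have h4 : d ^ 2 / l ^ 3 ≤ 1 / l ^ 2 := by
    rw [div_le_div_iff₀ (by positivity) (by positivity)]
    have : d ^ 2 ≤ l := by nlinarith
    nlinarith [sq_nonneg l]
  have h5 : (1 - ε) * m / l ^ 2 ≤ (d - 1 - E) / l ^ 2 := by
    gcongr
    linarith
  have h6 : (d - 1 - E) / l ^ 2 = d / l ^ 2 - 1 / l ^ 2 - E / l ^ 2 := by ring
  linarith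

theorem theta_div_log_next_prime_lower_eps (ε : ℝ) (hε0 : 0 < ε) (hε1 : ε < 1) :
    ∃ N : ℕ, ∀ n : ℕ, N ≤ n →
      (n : ℝ) * (1 - 1 / Real.log n +
          (1 - ε) * Real.log (Real.log n) / (Real.log n) ^ 2) ≤
        chebyshevTheta (nthPrime n) / Real.log (nthPrime (n + 1)) := by
  obtain ⟨E, hE0, hE⟩ := exists_mul_le_theta_div_log
  have hlog : Filter.Tendsto (fun n : ℕ ↦ Real.log n) Filter.atTop Filter.atTop :=
    Real.tendsto_log_atTop.comp tendsto_natCast_atTop_atTop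
  have hloglog := Real.tendsto_log_atTop.comp hlog
  have hsq : ∀ᶠ l : ℝ in Filter.atTop, Real.log l ^ 2 ≤ l := by
    filter_upwards [(tendsto_div_log_pow 2).eventually_ge_atTop 1,
      Filter.eventually_gt_atTop 1] with l h1 h2
    have := Real.log_pos h2
    rwa [one_le_div (by positivity)] at h1
  rw [← Filter.eventually_atTop]
  filter_upwards [hE, hlog.eventually hsq, hlog.eventually_gt_atTop 0,
    hloglog.eventually_ge_atTop 2, hloglog.eventually_ge_atTop ((3 + E) / ε)]
    with n ⟨h1, h2⟩ h3 h4 h5 h6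
  simp only [Function.comp_apply] at h5 h6
  rw [div_le_iff₀' hε0] at h6
  refine le_trans ?_ h1
  have := one_div_add_div_sq_le hE0 h4 h5 h3 h6 h2
  gcongr
  linarith
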